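/- arXiv:2603.10813 — 5 statements merged into one kernel-verified Lean document; each statement's English description precedes it below -/
import Mathlib

section
/- There exists an absolute constant C > 0 with the following property. Let (X,d) be a locally compact, σ-compact metric space and μ a positive σ-finite Borel measure on X that is finite on compact sets. Let Ω ⊆ X be a compact set satisfying Condition [C2] with inflation rate γ and inflation constant I(Ω), and let φ : X×X → [0,∞) be measurable. Then ∫_Ω ∫_{Ω^c} φ(x,y) dμ(y) dμ(x) ≤ C · I(Ω) · Σ_{n≥0} sup_{x∈X} ∫_{A_{n,x}} (1 + d(x,y))^γ φ(x,y) dμ(y). -/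
open MeasureTheory ENNReal Metric Filter

noncomputable section

namespace Paper

variable {X : Type*} [MetricSpace X] [MeasurableSpace X]

/-- The dyadic annuli `A_{n,x}`. -/
def dyadicAnnulus (x : X) : ℕ → Set X
  | 0 => Metric.ball x 1
  | (n+1) => Metric.ball x ((2:ℝ) ^ (n+1)) \ Metric.ball x ((2:ℝ) ^ n)

/-- The inflation constant `I(Ω)` with inflation rate `γ` (with the convention
`d(x,∅) = ∞`, implemented via `EMetric.infEdist`). -/
def inflationConst (μ : Measure X) (γ : ℝ) (Ω : Set X) : ℝ≥0∞ :=
  ⨆ (n : ℕ), ⨆ (E : Set X), ⨆ (_ : E = Ω ∨ E = Ωᶜ),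
    ENNReal.ofReal ((2:ℝ) ^ (-γ * ((n:ℝ) - 1))) *
      μ {x ∈ Eᶜ | EMetric.infEdist x E ≤ ENNReal.ofReal ((2:ℝ) ^ (n:ℕ))}

theorem measurableSet_dyadicAnnulus [OpensMeasurableSpace X] (x : X) (n : ℕ) :
    MeasurableSet (dyadicAnnulus x n) := by
  cases n with
  | zero => exact measurableSet_ball
  | succ n => exact measurableSet_ball.diff measurableSet_ball

theorem iUnion_dyadicAnnulus (x : X) : ⋃ n, dyadicAnnulus x n = Set.univ := by
  refine Set.eq_univ_of_forall fun y => Set.mem_iUnion.2 ?_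
  have hex : ∃ n : ℕ, dist y x < (2:ℝ) ^ n := pow_unbounded_of_one_lt _ one_lt_two
  classical
  refine ⟨Nat.find hex, ?_⟩
  have hlt := Nat.find_spec hex
  rcases hn : Nat.find hex with _ | n
  · rw [hn] at hlt
    simpa [dyadicAnnulus] using hlt
  · rw [hn] at hlt
    exact ⟨hlt, Nat.find_min hex (by omega)⟩

theorem dist_lt_of_mem_dyadicAnnulus {x y : X} {n : ℕ} (h : y ∈ dyadicAnnulus x n) :
    dist x y < (2:ℝ) ^ n := by
  rw [dist_comm]
  cases n with
  | zero => simpa [dyadicAnnulus] using h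
  | succ n => exact h.1

theorem two_rpow_sub_one_le_of_mem_dyadicAnnulus {x y : X} {n : ℕ}
    (h : y ∈ dyadicAnnulus x n) : (2:ℝ) ^ ((n:ℝ) - 1) ≤ 1 + dist x y := by
  cases n with
  | zero =>
    have h1 : (2:ℝ) ^ (((0:ℕ):ℝ) - 1) ≤ 1 :=
      Real.rpow_le_one_of_one_le_of_nonpos one_le_two (by norm_num)
    linarith [dist_nonneg (x := x) (y := y)]
  | succ n =>
    have h1 : (2:ℝ) ^ n ≤ dist y x := not_lt.1 h.2
    rw [Nat.cast_succ, add_sub_cancel_right, Real.rpow_natCast, dist_comm]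
    linarith

theorem one_le_two_rpow_mul_of_mem_dyadicAnnulus {x y : X} {n : ℕ} {γ : ℝ} (hγ : 0 ≤ γ)
    (h : y ∈ dyadicAnnulus x n) :
    1 ≤ (2:ℝ) ^ (-γ * ((n:ℝ) - 1)) * (1 + dist x y) ^ γ := by
  calc (1:ℝ) = (2:ℝ) ^ (-γ * ((n:ℝ) - 1)) * ((2:ℝ) ^ ((n:ℝ) - 1)) ^ γ := by
        rw [← Real.rpow_mul two_pos.le, ← Real.rpow_add two_pos]
        ring_nf
        simp
    _ ≤ _ := by
        gcongr
        exact two_rpow_sub_one_le_of_mem_dyadicAnnulus h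

/-- The points of `Ω` at distance at most `2 ^ n` from `Ωᶜ`. -/
def innerCollar (Ω : Set X) (n : ℕ) : Set X :=
  {x ∈ Ω | Metric.infEDist x Ωᶜ ≤ ENNReal.ofReal ((2:ℝ) ^ n)}

theorem measurableSet_innerCollar [OpensMeasurableSpace X] {Ω : Set X} (hΩ : MeasurableSet Ω)
    (n : ℕ) : MeasurableSet (innerCollar Ω n) :=
  hΩ.inter (measurable_infEDist measurableSet_Iic)

theorem mul_measure_innerCollar_le (μ : Measure X) (γ : ℝ) (Ω : Set X) (n : ℕ) :
    ENNReal.ofReal ((2:ℝ) ^ (-γ * ((n:ℝ) - 1))) * μ (innerCollar Ω n) ≤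
      inflationConst μ γ Ω := by
  have h := le_iSup_of_le (f := fun n : ℕ => ⨆ (E : Set X), ⨆ (_ : E = Ω ∨ E = Ωᶜ),
    ENNReal.ofReal ((2:ℝ) ^ (-γ * ((n:ℝ) - 1))) *
      μ {x ∈ Eᶜ | Metric.infEDist x E ≤ ENNReal.ofReal ((2:ℝ) ^ (n:ℕ))}) n
    (le_iSup₂_of_le Ωᶜ (Or.inr rfl) le_rfl)
  rwa [compl_compl] at h

theorem mem_innerCollar_of_mem_dyadicAnnulus {Ω : Set X} {x y : X} {n : ℕ} (hx : x ∈ Ω)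
    (hy : y ∈ Ωᶜ) (h : y ∈ dyadicAnnulus x n) : x ∈ innerCollar Ω n := by
  refine ⟨hx, (Metric.infEDist_le_edist_of_mem hy).trans ?_⟩
  rw [edist_dist]
  exact ENNReal.ofReal_le_ofReal (dist_lt_of_mem_dyadicAnnulus h).le

theorem setLIntegral_dyadicAnnulus_le [OpensMeasurableSpace X] (μ : Measure X) {γ : ℝ}
    (hγ : 0 ≤ γ) {f : X → ℝ} (hf : ∀ y, 0 ≤ f y) (x : X) (n : ℕ) :
    ∫⁻ y in dyadicAnnulus x n, ENNReal.ofReal (f y) ∂μ ≤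
      ENNReal.ofReal ((2:ℝ) ^ (-γ * ((n:ℝ) - 1))) *
        ∫⁻ y in dyadicAnnulus x n, ENNReal.ofReal ((1 + dist x y) ^ γ * f y) ∂μ := by
  rw [← lintegral_const_mul' _ _ ENNReal.ofReal_ne_top]
  refine setLIntegral_mono' (measurableSet_dyadicAnnulus x n) fun y hy => ?_
  rw [← ENNReal.ofReal_mul (by positivity), ← mul_assoc]
  exact ENNReal.ofReal_le_ofReal
    (le_mul_of_one_le_left (hf y) (one_le_two_rpow_mul_of_mem_dyadicAnnulus hγ hy))

/-- The part of the inner integral at scale `n` vanishes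
unless `x` lies in the inner collar of width `2 ^ n`. -/
theorem setLIntegral_compl_le_tsum_innerCollar [OpensMeasurableSpace X] (μ : Measure X) {γ : ℝ}
    (hγ : 0 ≤ γ) {φ : X → X → ℝ} (hφ : ∀ x y, 0 ≤ φ x y) {Ω : Set X} {x : X} (hx : x ∈ Ω) :
    ∫⁻ y in Ωᶜ, ENNReal.ofReal (φ x y) ∂μ ≤
      ∑' n : ℕ, (innerCollar Ω n).indicator
        (fun _ => ENNReal.ofReal ((2:ℝ) ^ (-γ * ((n:ℝ) - 1))) *
          ⨆ x : X, ∫⁻ y in dyadicAnnulus x n,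
            ENNReal.ofReal ((1 + dist x y) ^ γ * φ x y) ∂μ) x := by
  rw [← Set.inter_univ Ωᶜ, ← iUnion_dyadicAnnulus x, Set.inter_iUnion]
  refine (lintegral_iUnion_le _ _).trans (ENNReal.tsum_le_tsum fun n => ?_)
  by_cases hxn : x ∈ innerCollar Ω n
  · rw [Set.indicator_of_mem hxn]
    refine (lintegral_mono_set Set.inter_subset_right).trans
      ((setLIntegral_dyadicAnnulus_le μ hγ (hφ x) x n).trans ?_)
    gcongr
    exact le_iSup (fun x : X => ∫⁻ y in dyadicAnnulus x n,
      ENNReal.ofReal ((1 + dist x y) ^ γ * φ x y) ∂μ) x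
  · have hempty : Ωᶜ ∩ dyadicAnnulus x n = ∅ := Set.eq_empty_of_forall_notMem
      fun y hy => hxn (mem_innerCollar_of_mem_dyadicAnnulus hx hy.1 hy.2)
    simp [hempty]

/-- Lemma `lem:p2`: first non-local perimeter estimate.
There is an absolute constant `C > 0` such that under Condition [C2],
`∫_Ω ∫_{Ω^c} φ(x,y) dμ(y) dμ(x) ≤ C · I(Ω) · Σ_n sup_x ∫_{A_{n,x}} (1+d(x,y))^γ φ(x,y) dμ(y)`. -/
theorem statement6 :
    ∃ C : ℝ, 0 < C ∧
      ∀ (X : Type) (_ : MetricSpace X) (_ : MeasurableSpace X), ∀ (_ : BorelSpace X)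
        (_ : LocallyCompactSpace X) (_ : SigmaCompactSpace X)
        (μ : Measure X) (_ : SigmaFinite μ) (_ : IsFiniteMeasureOnCompacts μ)
        (Ω : Set X) (_ : IsCompact Ω)
        (γ : ℝ) (_ : 0 < γ) (_ : inflationConst μ γ Ω ≠ ⊤)
        (φ : X → X → ℝ) (_ : Measurable (Function.uncurry φ)) (_ : ∀ x y, 0 ≤ φ x y),
        ∫⁻ x in Ω, ∫⁻ y in Ωᶜ, ENNReal.ofReal (φ x y) ∂μ ∂μ ≤
          ENNReal.ofReal C * inflationConst μ γ Ω *
            ∑' n : ℕ, ⨆ x : X,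
              ∫⁻ y in dyadicAnnulus x n, ENNReal.ofReal ((1 + dist x y) ^ γ * φ x y) ∂μ := by
  refine ⟨1, one_pos, ?_⟩
  intro X _ _ _ _ _ μ _ _ Ω hΩ γ hγ _ φ _ hφ
  rw [ENNReal.ofReal_one, one_mul, ← ENNReal.tsum_mul_left]
  refine (setLIntegral_mono' hΩ.measurableSet fun x hx =>
    setLIntegral_compl_le_tsum_innerCollar μ hγ.le hφ hx).trans ?_
  have hS := measurableSet_innerCollar hΩ.measurableSet
  rw [lintegral_tsum fun n => (measurable_const.indicator (hS n)).aemeasurable]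
  refine ENNReal.tsum_le_tsum fun n => ?_
  refine (setLIntegral_le_lintegral _ _).trans ((lintegral_indicator_const_le _ _).trans ?_)
  rw [mul_right_comm]
  gcongr
  exact mul_measure_innerCollar_le μ γ Ω n

end Paper
end
end

section
/- Let (X,d) be an M-quasiconvex metric space carrying a Borel measure μ satisfying Condition [C3] with doubling constant C_X, and set γ = log₂(C_X). Let Ω ⊆ X be compact and let E denote either Ω or Ω^c. Then for every R > 0: μ({x ∈ E^c : d(x,E) ≤ R}) ≤ (8M)^γ · max{R^γ, 1} · μ({x ∈ X : d(x,∂Ω) ≤ 1}). -/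
open MeasureTheory ENNReal Metric Filter

noncomputable section

namespace Paper

variable {X : Type*} [MetricSpace X]

/-- A metric space is `M`-quasiconvex if any two points are joined by a curve of
length at most `M` times their distance.  The length of a curve is its total
variation (`eVariationOn`). -/
def IsQuasiconvex (X : Type*) [MetricSpace X] (M : ℝ) : Prop :=
  ∀ x y : X, ∃ (a b : ℝ) (σ : ℝ → X), a ≤ b ∧ ContinuousOn σ (Set.Icc a b) ∧
    σ a = x ∧ σ b = y ∧ eVariationOn σ (Set.Icc a b) ≤ ENNReal.ofReal (M * dist x y)

theorem _root_.IsPreconnected.inter_frontier_nonempty_of_mem {Y : Type*} [TopologicalSpace Y]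
    {s E : Set Y} (hs : IsPreconnected s) {x y : Y} (hxs : x ∈ s) (hx : x ∉ E) (hys : y ∈ s)
    (hy : y ∈ E) : (s ∩ frontier E).Nonempty := by
  by_contra h
  have key : ∀ z ∈ s, z ∈ closure E → z ∈ interior E := fun z hz hzc ↦
    by_contra fun hzi ↦ h ⟨z, hz, hzc, hzi⟩
  obtain ⟨z, -, hzi, hzc⟩ := hs (interior E) (closure E)ᶜ isOpen_interior
    isClosed_closure.isOpen_compl
    (fun z hz ↦ (em (z ∈ closure E)).imp (key z hz) id)
    ⟨y, hys, key y hys (subset_closure hy)⟩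
    ⟨x, hxs, fun hxc ↦ hx (interior_subset (key x hxs hxc))⟩
  exact hzc (subset_closure (interior_subset hzi))

theorem IsQuasiconvex.infEDist_frontier_le {M : ℝ} (hM : 0 < M) (hX : IsQuasiconvex X M)
    {E : Set X} {x : X} (hx : x ∉ E) :
    infEDist x (frontier E) ≤ ENNReal.ofReal M * infEDist x E := by
  rw [← ENNReal.div_le_iff' (by simpa using hM) ENNReal.ofReal_ne_top, le_infEDist]
  intro y hy
  rw [ENNReal.div_le_iff' (by simpa using hM) ENNReal.ofReal_ne_top]
  obtain ⟨a, b, σ, hab, hσ, rfl, rfl, hlen⟩ := hX x y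
  have ha : a ∈ Set.Icc a b := Set.left_mem_Icc.2 hab
  have hb : b ∈ Set.Icc a b := Set.right_mem_Icc.2 hab
  obtain ⟨_, ⟨t, ht, rfl⟩, htE⟩ :=
    (isPreconnected_Icc.image σ hσ).inter_frontier_nonempty_of_mem
      (Set.mem_image_of_mem σ ha) hx (Set.mem_image_of_mem σ hb) hy
  calc infEDist (σ a) (frontier E) ≤ edist (σ a) (σ t) := infEDist_le_edist_of_mem htE
    _ ≤ eVariationOn σ (Set.Icc a b) := eVariationOn.edist_le σ ha ht
    _ ≤ ENNReal.ofReal M * edist (σ a) (σ b) := by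
      rwa [edist_dist, ← ENNReal.ofReal_mul hM.le]

theorem measure_ball_two_pow_mul_le [MeasurableSpace X] {μ : Measure X} {C : ℝ≥0∞}
    (hμ : ∀ (x : X) (r : ℝ), 0 < r → μ (ball x (2 * r)) ≤ C * μ (ball x r))
    (x : X) {r : ℝ} (hr : 0 < r) (n : ℕ) : μ (ball x (2 ^ n * r)) ≤ C ^ n * μ (ball x r) := by
  induction n with
  | zero => simp
  | succ n ih =>
    calc μ (ball x (2 ^ (n + 1) * r)) = μ (ball x (2 * (2 ^ n * r))) := by ring_nf
      _ ≤ C * μ (ball x (2 ^ n * r)) := hμ x _ (by positivity)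
      _ ≤ C * (C ^ n * μ (ball x r)) := by gcongr
      _ = C ^ (n + 1) * μ (ball x r) := by ring

theorem _root_.IsCompact.exists_finset_isSeparated_isCover {A : Set X} (hA : IsCompact A)
    {ε : NNReal} (hε : ε ≠ 0) :
    ∃ s : Finset X, (s : Set X) ⊆ A ∧ IsSeparated ε (s : Set X) ∧ IsCover ε A s := by
  have hfin : packingNumber ε A ≠ ⊤ := by
    obtain ⟨N, -, hN, hcov⟩ := exists_finite_isCover_of_isCompact (half_pos hε.bot_lt).ne' hA
    have h := packingNumber_two_mul_le_externalCoveringNumber (ε / 2) A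
    rw [mul_div_cancel₀ ε two_ne_zero] at h
    exact ne_top_of_le_ne_top hN.encard_lt_top.ne
      (h.trans hcov.externalCoveringNumber_le_encard)
  have hsfin : (maximalSeparatedSet ε A).Finite := by
    rw [← Set.encard_ne_top_iff, encard_maximalSeparatedSet hfin]
    exact hfin
  exact ⟨hsfin.toFinset, by simpa using maximalSeparatedSet_subset,
    by simpa using isSeparated_maximalSeparatedSet, by simpa using isCover_maximalSeparatedSet hfin⟩

/-- In a doubling space, a neighbourhood of a compact set is controlled by its
`1`-neighbourhood. -/
theorem measure_infEDist_le_pow_mul [MeasurableSpace X] [BorelSpace X] {μ : Measure X} {C : ℝ≥0∞}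
    (hμ : ∀ (x : X) (r : ℝ), 0 < r → μ (ball x (2 * r)) ≤ C * μ (ball x r))
    {A : Set X} (hA : IsCompact A) {r : ℝ} (hr : 0 ≤ r) {n : ℕ} (hn : r + 2 < 2 ^ n) :
    μ {x | infEDist x A ≤ ENNReal.ofReal r} ≤ C ^ n * μ {x | infEDist x A ≤ 1} := by
  obtain ⟨s, hsA, hsep, hcov⟩ := hA.exists_finset_isSeparated_isCover (two_ne_zero (α := NNReal))
  have hsub : {x | infEDist x A ≤ ENNReal.ofReal r} ⊆ ⋃ p ∈ s, ball p (2 ^ n * 1) := by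
    intro x hx
    rw [Set.mem_ofPred_eq] at hx
    have hne : A.Nonempty := by
      rw [Set.nonempty_iff_ne_empty]
      rintro rfl
      simp at hx
    obtain ⟨q, hqA, hq⟩ := hA.exists_infEDist_eq_edist hne x
    obtain ⟨p, hps, hqp⟩ := hcov hqA
    have hxq : dist x q ≤ r := by rwa [hq, edist_le_ofReal hr] at hx
    have hqp' : dist q p ≤ 2 := by
      have : edist q p ≤ ENNReal.ofReal 2 := by simpa using hqp
      rwa [edist_le_ofReal zero_le_two] at this
    have := dist_triangle x q p
    simp only [Set.mem_iUnion, mem_ball]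
    exact ⟨p, hps, by linarith⟩
  have hdisj : (s : Set X).PairwiseDisjoint fun p ↦ ball p 1 := by
    intro p hp q hq hpq
    refine ball_disjoint_ball ?_
    have : ENNReal.ofReal 2 < edist p q := by simpa using hsep hp hq hpq
    rw [edist_dist, ENNReal.ofReal_lt_ofReal_iff_of_nonneg zero_le_two] at this
    linarith
  have hunion : ⋃ p ∈ s, ball p 1 ⊆ {x | infEDist x A ≤ 1} := by
    refine Set.iUnion₂_subset fun p hp x hx ↦ (infEDist_le_edist_of_mem (hsA hp)).trans ?_
    rw [← ENNReal.ofReal_one, edist_le_ofReal zero_le_one]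
    exact (mem_ball.1 hx).le
  calc μ {x | infEDist x A ≤ ENNReal.ofReal r}
      ≤ μ (⋃ p ∈ s, ball p (2 ^ n * 1)) := measure_mono hsub
    _ ≤ ∑ p ∈ s, μ (ball p (2 ^ n * 1)) := measure_biUnion_finset_le _ _
    _ ≤ ∑ p ∈ s, C ^ n * μ (ball p 1) :=
      Finset.sum_le_sum fun p _ ↦ measure_ball_two_pow_mul_le hμ p one_pos n
    _ = C ^ n * μ (⋃ p ∈ s, ball p 1) := by
      rw [measure_biUnion_finset hdisj fun p _ ↦ measurableSet_ball, Finset.mul_sum]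
    _ ≤ C ^ n * μ {x | infEDist x A ≤ 1} := by gcongr

theorem pow_le_rpow_logb_two {C t : ℝ} (hC : 1 ≤ C) {n : ℕ} (hn : 2 ^ n ≤ t) :
    C ^ n ≤ t ^ Real.logb 2 C := by
  have hγ : 0 ≤ Real.logb 2 C := Real.logb_nonneg one_lt_two hC
  calc C ^ n = ((2 : ℝ) ^ Real.logb 2 C) ^ n := by
        rw [Real.rpow_logb two_pos (by norm_num) (by linarith)]
    _ = ((2 : ℝ) ^ n) ^ Real.logb 2 C := (Real.rpow_pow_comm zero_le_two _ n)
    _ ≤ t ^ Real.logb 2 C := by gcongr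

/-- Proposition `reduct`, estimate (eqred1).  Let `X` be an
`M`-quasiconvex metric space with a doubling measure `μ` (constant `C_X`) and set
`γ = log₂ C_X`.  For compact `Ω` and `E ∈ {Ω, Ω^c}`, and every `R > 0`,
`μ({x ∈ E^c : d(x,E) ≤ R}) ≤ (8M)^γ · max{R^γ, 1} · μ({x : d(x,∂Ω) ≤ 1})`
(with the convention `d(x,∅) = ∞`). -/
theorem statement8 :
    ∀ (X : Type) (_ : MetricSpace X) (_ : MeasurableSpace X), ∀ (_ : BorelSpace X)
      (M : ℝ), 1 ≤ M → IsQuasiconvex X M →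
      ∀ (μ : Measure X)
      -- Condition [C3]: μ is doubling with constant C_X
      (CX : ℝ), 1 ≤ CX →
      (∀ (x : X) (r : ℝ), 0 < r → 0 < μ (Metric.ball x (2 * r)) ∧
        μ (Metric.ball x (2 * r)) ≤ ENNReal.ofReal CX * μ (Metric.ball x r)) →
      ∀ (Ω : Set X), IsCompact Ω →
      ∀ (E : Set X), (E = Ω ∨ E = Ωᶜ) →
      ∀ (R : ℝ), 0 < R →
        μ {x ∈ Eᶜ | EMetric.infEdist x E ≤ ENNReal.ofReal R} ≤
          ENNReal.ofReal ((8 * M) ^ (Real.logb 2 CX) * max (R ^ (Real.logb 2 CX)) 1) *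
            μ {x : X | EMetric.infEdist x (frontier Ω) ≤ 1} := by
  intro X _ _ _ M hM hX μ CX hCX hμ Ω hΩ E hE R hR
  have hγ : 0 ≤ Real.logb 2 CX := Real.logb_nonneg one_lt_two hCX
  have hMR : 0 ≤ M * R := by positivity
  have hEΩ : frontier E = frontier Ω := by
    rcases hE with rfl | rfl
    · rfl
    · exact frontier_compl Ω
  obtain ⟨n, hn, hn'⟩ :=
    exists_nat_pow_near (show 1 ≤ M * R + 2 by linarith) (one_lt_two (α := ℝ))
  have hpow : CX ^ (n + 1) ≤ (8 * M) ^ Real.logb 2 CX * max (R ^ Real.logb 2 CX) 1 := by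
    have hmax : max (R ^ Real.logb 2 CX) 1 = max R 1 ^ Real.logb 2 CX := by
      rw [(Real.monotoneOn_rpow_Ici_of_exponent_nonneg hγ).map_max (Set.mem_Ici.2 hR.le)
        (Set.mem_Ici.2 zero_le_one),
        Real.one_rpow]
    rw [hmax, ← Real.mul_rpow (by positivity) (by positivity)]
    refine pow_le_rpow_logb_two hCX ?_
    have h1 : M * R ≤ M * max R 1 := by gcongr; exact le_max_left ..
    have h2 : 1 ≤ M * max R 1 := one_le_mul_of_one_le_of_one_le hM (le_max_right ..)
    rw [pow_succ]
    linarith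
  calc μ {x ∈ Eᶜ | infEDist x E ≤ ENNReal.ofReal R}
      ≤ μ {x | infEDist x (frontier Ω) ≤ ENNReal.ofReal (M * R)} := by
        refine measure_mono fun x hx ↦ ?_
        rw [Set.mem_ofPred_eq, ← hEΩ, ENNReal.ofReal_mul (by linarith)]
        exact (hX.infEDist_frontier_le (by linarith) hx.1).trans (by gcongr; exact hx.2)
    _ ≤ ENNReal.ofReal CX ^ (n + 1) * μ {x | infEDist x (frontier Ω) ≤ 1} :=
        measure_infEDist_le_pow_mul (fun x r hr ↦ (hμ x r hr).2)
          (hΩ.of_isClosed_subset isClosed_frontier hΩ.isClosed.frontier_subset) hMR hn'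
    _ ≤ _ := by
        rw [← ENNReal.ofReal_pow (by linarith)]
        gcongr
        rfl

end Paper
end
end

section
/- Let (X,d) be an M-quasiconvex metric space carrying a Borel measure μ satisfying Condition [C3] with doubling constant C_X, and set γ = log₂(C_X). Let Ω ⊆ X be compact and suppose ∂Ω is regular at scale η > 0 with constant κ > 0 (with respect to the codimension-one Hausdorff measure 𝓗). Let E denote either Ω or Ω^c. Then for every R > 0: μ({x ∈ E^c : d(x,E) ≤ R}) ≤ ((8M)^γ / κ) · R · (1 + (R/η)^{γ−1}) · 𝓗(∂Ω). -/
open MeasureTheory ENNReal Metric Filter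

noncomputable section

namespace Paper

variable {X : Type*} [MetricSpace X] [MeasurableSpace X]

/-- Pre-measure `𝓗_r(E)`: infimum over at most countable covers of `E` by balls of
radii at most `r` of `Σ_j μ(B_{r_j}(x_j))/r_j`. -/
def hausPre (μ : Measure X) (r : ℝ) (E : Set X) : ℝ≥0∞ :=
  ⨅ (J : Set ℕ) (c : ℕ → X) (ρ : ℕ → ℝ)
    (_ : ∀ j ∈ J, 0 < ρ j ∧ ρ j ≤ r) (_ : E ⊆ ⋃ j ∈ J, Metric.ball (c j) (ρ j)),
    ∑' j : J, μ (Metric.ball (c j) (ρ j)) / ENNReal.ofReal (ρ j)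

/-- The codimension-one Hausdorff measure `𝓗(E) = lim_{r→0⁺} 𝓗_r(E)`
(the limit being a supremum by monotonicity). -/
def codimOneHausdorff (μ : Measure X) (E : Set X) : ℝ≥0∞ :=
  ⨆ (r : ℝ) (_ : 0 < r), hausPre μ r E

/-- A Borel set `E` is regular at scale `η > 0` with constant `κ > 0` if
`𝓗(E ∩ B_r(x)) ≥ κ · μ(B_r(x))/r` for every `x ∈ E` and `0 < r ≤ η`. -/
def IsRegularAtScale (μ : Measure X) (E : Set X) (η κ : ℝ) : Prop :=
  ∀ x ∈ E, ∀ r : ℝ, 0 < r → r ≤ η →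
    ENNReal.ofReal (κ / r) * μ (Metric.ball x r) ≤ codimOneHausdorff μ (E ∩ Metric.ball x r)

lemma hausPre_anti (μ : Measure X) {r s : ℝ} (h : r ≤ s) (E : Set X) :
    hausPre μ s E ≤ hausPre μ r E := by
  unfold hausPre
  gcongr with J c ρ
  exact iInf_mono' fun h1 => ⟨fun j hj => ⟨(h1 j hj).1, (h1 j hj).2.trans h⟩, le_rfl⟩

lemma hausPre_mono (μ : Measure X) (r : ℝ) {E F : Set X} (h : E ⊆ F) :
    hausPre μ r E ≤ hausPre μ r F := by
  unfold hausPre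
  gcongr with J c ρ h1
  exact iInf_mono' fun h2 => ⟨h.trans h2, le_rfl⟩

/-- The pre-measure `𝓗_r` is superadditive on families at mutual distance at least `2 r`. -/
lemma sum_hausPre_le (μ : Measure X) {ι : Type*} (s : Finset ι) (A : ι → Set X) {r : ℝ}
    (hsep : ∀ i ∈ s, ∀ j ∈ s, i ≠ j → ∀ p ∈ A i, ∀ q ∈ A j, 2 * r ≤ dist p q) {E : Set X}
    (hE : ∀ i ∈ s, A i ⊆ E) :
    ∑ i ∈ s, hausPre μ r (A i) ≤ hausPre μ r E := by
  classical
  conv_rhs => unfold hausPre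
  refine le_iInf fun J => le_iInf fun c => le_iInf fun ρ => le_iInf fun hρ => le_iInf fun hcov => ?_
  let f : ℕ → ℝ≥0∞ := fun j => μ (ball (c j) (ρ j)) / ENNReal.ofReal (ρ j)
  let K : ι → Set ℕ := fun i => {j | j ∈ J ∧ (ball (c j) (ρ j) ∩ A i).Nonempty}
  have hK : ∀ i ∈ s, hausPre μ r (A i) ≤ ∑' n, (K i).indicator f n := by
    intro i hi
    rw [← tsum_subtype (K i) f]
    unfold hausPre
    refine iInf_le_of_le (K i) <| iInf_le_of_le c <| iInf_le_of_le ρ <|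
      iInf_le_of_le (fun j hj => hρ j hj.1) <| iInf_le_of_le (fun p hp => ?_) le_rfl
    obtain ⟨j, hj, hpj⟩ := Set.mem_iUnion₂.1 (hcov (hE i hi hp))
    exact Set.mem_iUnion₂.2 ⟨j, ⟨hj, p, hpj, hp⟩, hpj⟩
  calc ∑ i ∈ s, hausPre μ r (A i) ≤ ∑ i ∈ s, ∑' n, (K i).indicator f n := Finset.sum_le_sum hK
    _ = ∑' n, ∑ i ∈ s, (K i).indicator f n :=
        (Summable.tsum_finsetSum fun _ _ => ENNReal.summable).symm
    _ ≤ ∑' n, J.indicator f n := by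
        refine ENNReal.tsum_le_tsum fun n => ?_
        by_cases h : ∃ i ∈ s, n ∈ K i
        · obtain ⟨i, hi, hn⟩ := h
          rw [Finset.sum_eq_single_of_mem i hi, Set.indicator_of_mem hn, Set.indicator_of_mem hn.1]
          intro j hj hji
          refine Set.indicator_of_notMem (fun hn' => ?_) f
          obtain ⟨hnJ, p, hp, hpA⟩ := hn
          obtain ⟨-, q, hq, hqA⟩ := hn'
          have h1 := hsep i hi j hj hji.symm p hpA q hqA
          have h2 := dist_triangle_right p q (c n)
          rw [mem_ball] at hp hq
          linarith [(hρ n hnJ).2]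
        · push Not at h
          rw [Finset.sum_eq_zero fun i hi => Set.indicator_of_notMem (h i hi) f]
          exact zero_le
    _ = ∑' j : J, f j := (tsum_subtype J f).symm

/-- The codimension-one Hausdorff measure is superadditive on finite families of uniformly
separated sets. -/
lemma sum_codimOneHausdorff_le (μ : Measure X) {ι : Type*} (s : Finset ι) (A : ι → Set X) {δ : ℝ}
    (hδ : 0 < δ)
    (hsep : ∀ i ∈ s, ∀ j ∈ s, i ≠ j → ∀ p ∈ A i, ∀ q ∈ A j, δ ≤ dist p q) {E : Set X}
    (hE : ∀ i ∈ s, A i ⊆ E) :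
    ∑ i ∈ s, codimOneHausdorff μ (A i) ≤ codimOneHausdorff μ E := by
  have hsup : ∀ F : Set X, codimOneHausdorff μ F = ⨆ r : {r : ℝ // 0 < r}, hausPre μ r F :=
    fun F => (iSup_subtype (f := fun r : {r : ℝ // 0 < r} => hausPre μ r F)).symm
  have hdir : ∀ a b : {r : ℝ // 0 < r}, ∃ k : {r : ℝ // 0 < r}, ∀ i,
      hausPre μ a (A i) ≤ hausPre μ k (A i) ∧ hausPre μ b (A i) ≤ hausPre μ k (A i) := fun a b =>
    ⟨⟨min (a : ℝ) b, lt_min a.2 b.2⟩, fun i =>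
      ⟨hausPre_anti μ (min_le_left (a : ℝ) b) _, hausPre_anti μ (min_le_right (a : ℝ) b) _⟩⟩
  calc ∑ i ∈ s, codimOneHausdorff μ (A i)
      = ∑ i ∈ s, ⨆ r : {r : ℝ // 0 < r}, hausPre μ r (A i) :=
        Finset.sum_congr rfl fun i _ => hsup (A i)
    _ = ⨆ r : {r : ℝ // 0 < r}, ∑ i ∈ s, hausPre μ r (A i) := ENNReal.finsetSum_iSup hdir
    _ ≤ ⨆ r : {r : ℝ // 0 < r}, hausPre μ r E := iSup_le fun r => ?_
    _ = codimOneHausdorff μ E := (hsup E).symm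
  have hr : 0 < min (r : ℝ) (δ / 2) := lt_min r.2 (half_pos hδ)
  refine le_trans ?_ (le_iSup (fun r : {r : ℝ // 0 < r} => hausPre μ r E) ⟨_, hr⟩)
  refine (Finset.sum_le_sum fun i _ => hausPre_anti μ (min_le_left (r : ℝ) (δ / 2)) _).trans
    (sum_hausPre_le μ s A (fun i hi j hj hij p hp q hq => ?_) hE)
  linarith [hsep i hi j hj hij p hp q hq, min_le_right (r : ℝ) (δ / 2)]

/-- The volume growth bound implied by the doubling condition. -/
lemma measure_ball_mul_le {μ : Measure X} {CX : ℝ} (hCX : 1 ≤ CX)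
    (hdoub : ∀ (x : X) (r : ℝ), 0 < r →
      μ (ball x (2 * r)) ≤ ENNReal.ofReal CX * μ (ball x r))
    (x : X) {r l : ℝ} (hr : 0 < r) (hl : 1 ≤ l) :
    μ (ball x (l * r)) ≤ ENNReal.ofReal ((2 * l) ^ Real.logb 2 CX) * μ (ball x r) := by
  have hiter : ∀ n : ℕ, μ (ball x (2 ^ n * r)) ≤ ENNReal.ofReal (CX ^ n) * μ (ball x r) := by
    intro n
    induction n with
    | zero => simp
    | succ n ih =>
      calc μ (ball x (2 ^ (n + 1) * r)) = μ (ball x (2 * (2 ^ n * r))) := by ring_nf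
        _ ≤ ENNReal.ofReal CX * μ (ball x (2 ^ n * r)) := hdoub x _ (by positivity)
        _ ≤ ENNReal.ofReal CX * (ENNReal.ofReal (CX ^ n) * μ (ball x r)) := by gcongr
        _ = ENNReal.ofReal (CX ^ (n + 1)) * μ (ball x r) := by
          rw [← mul_assoc, ← ENNReal.ofReal_mul (by linarith), pow_succ']
  obtain ⟨n, hn1, hn2⟩ := exists_nat_pow_near hl (one_lt_two : (1 : ℝ) < 2)
  have hγ : 0 ≤ Real.logb 2 CX := Real.logb_nonneg one_lt_two hCX
  calc μ (ball x (l * r)) ≤ μ (ball x (2 ^ (n + 1) * r)) := by gcongr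
    _ ≤ ENNReal.ofReal (CX ^ (n + 1)) * μ (ball x r) := hiter _
    _ ≤ ENNReal.ofReal ((2 * l) ^ Real.logb 2 CX) * μ (ball x r) := by
      gcongr
      calc CX ^ (n + 1) = ((2 : ℝ) ^ Real.logb 2 CX) ^ (n + 1) := by
            rw [Real.rpow_logb two_pos (by norm_num) (by linarith)]
        _ = ((2 : ℝ) ^ (n + 1)) ^ Real.logb 2 CX := by
            rw [← Real.rpow_mul_natCast zero_le_two, mul_comm, Real.rpow_natCast_mul zero_le_two]
        _ ≤ (2 * l) ^ Real.logb 2 CX := by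
            gcongr
            rw [pow_succ']
            gcongr

lemma _root_.IsPreconnected.nonempty_inter_frontier {Y : Type*} [TopologicalSpace Y] {s t : Set Y}
    (hs : IsPreconnected s) (h1 : (s ∩ t).Nonempty) (h2 : (s ∩ tᶜ).Nonempty) :
    (s ∩ frontier t).Nonempty := by
  by_contra hne
  have hcov : s ⊆ interior t ∪ interior tᶜ := by
    intro x hx
    by_contra hx'
    rw [interior_compl, Set.mem_union, Set.mem_compl_iff, not_or, not_not] at hx'
    exact hne ⟨x, hx, hx'.2, hx'.1⟩
  obtain ⟨x, hxs, hxt⟩ := h1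
  obtain ⟨y, hys, hyt⟩ := h2
  rcases hs.subset_or_subset isOpen_interior isOpen_interior
    (disjoint_compl_right.mono interior_subset interior_subset) hcov with h | h
  · exact hyt (interior_subset (h hys))
  · exact interior_subset (h hxs) hxt

lemma IsQuasiconvex.exists_mem_frontier {Y : Type*} [MetricSpace Y] {M : ℝ}
    (hX : IsQuasiconvex Y M) {E : Set Y} {x y : Y}
    (hx : x ∉ E) (hy : y ∈ E) : ∃ z ∈ frontier E, edist x z ≤ ENNReal.ofReal (M * dist x y) := by
  obtain ⟨a, b, σ, hab, hσ, rfl, rfl, hlen⟩ := hX x y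
  have ha : a ∈ Set.Icc a b := Set.left_mem_Icc.2 hab
  have hb : b ∈ Set.Icc a b := Set.right_mem_Icc.2 hab
  obtain ⟨z, ⟨t, ht, rfl⟩, hz⟩ := (isPreconnected_Icc.image σ hσ).nonempty_inter_frontier
    ⟨σ b, Set.mem_image_of_mem σ hb, hy⟩ ⟨σ a, Set.mem_image_of_mem σ ha, hx⟩
  exact ⟨σ t, hz, (eVariationOn.edist_le σ ha ht).trans hlen⟩

/-- A totally bounded set `A` has a finite subset of points at mutual distance more than `r`
such that every point of `A` is within `r` of one of them. -/
lemma exists_finset_separated_cover {Y : Type*} [MetricSpace Y] {A : Set Y}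
    (hA : TotallyBounded A) {r : ℝ} (hr : 0 < r) :
    ∃ s : Finset Y, ↑s ⊆ A ∧ (∀ x ∈ s, ∀ y ∈ s, x ≠ y → r < dist x y) ∧
      ∀ z ∈ A, ∃ x ∈ s, dist z x ≤ r := by
  lift r to NNReal using hr.le
  have hr' : r / 2 ≠ 0 := by simpa using hr.ne'
  obtain ⟨N, -, hNfin, hN⟩ := exists_finite_isCover_of_totallyBounded hr' hA
  have htop : packingNumber r A ≠ ⊤ := by
    refine ne_top_of_le_ne_top (Set.encard_ne_top_iff.2 hNfin) ?_
    calc packingNumber r A = packingNumber (2 * (r / 2)) A := by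
          rw [mul_div_cancel₀ r two_ne_zero]
      _ ≤ externalCoveringNumber (r / 2) A := packingNumber_two_mul_le_externalCoveringNumber _ _
      _ ≤ N.encard := hN.externalCoveringNumber_le_encard
  have hfin : (maximalSeparatedSet r A).Finite := by
    rw [← Set.encard_ne_top_iff, encard_maximalSeparatedSet htop]
    exact htop
  refine ⟨hfin.toFinset, by simpa using maximalSeparatedSet_subset, fun x hx y hy hxy => ?_,
    fun z hz => ?_⟩
  · have h : (r : ℝ≥0∞) < edist x y := isSeparated_maximalSeparatedSet (hfin.mem_toFinset.1 hx) (hfin.mem_toFinset.1 hy) hxy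
    rw [edist_nndist, ENNReal.coe_lt_coe] at h
    exact_mod_cast h
  · obtain ⟨x, hx, hzx⟩ := isCover_maximalSeparatedSet htop hz
    refine ⟨x, hfin.mem_toFinset.2 hx, ?_⟩
    replace hzx : edist z x ≤ (r : ℝ≥0∞) := hzx
    rw [edist_nndist, ENNReal.coe_le_coe] at hzx
    exact_mod_cast hzx

/-- If `A` is totally bounded and regular at scale `η`, the codimension-one Hausdorff measure of
`A` controls the measure of every set covered by `l r`-balls around `2 r`-nets of `A`. -/
lemma measure_le_of_isRegularAtScale {μ : Measure X} {CX : ℝ} (hCX : 1 ≤ CX)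
    (hdoub : ∀ (x : X) (r : ℝ), 0 < r →
      μ (ball x (2 * r)) ≤ ENNReal.ofReal CX * μ (ball x r))
    {A : Set X} (hA : TotallyBounded A) {η κ : ℝ} (hκ : 0 < κ) (hreg : IsRegularAtScale μ A η κ)
    {r l : ℝ} (hr : 0 < r) (hrη : r ≤ η) (hl : 1 ≤ l) {S : Set X}
    (hS : ∀ x ∈ S, ∃ z ∈ A, dist x z + 2 * r < l * r) :
    μ S ≤ ENNReal.ofReal ((2 * l) ^ Real.logb 2 CX * (r / κ)) * codimOneHausdorff μ A := by
  obtain ⟨s, hsA, hsep, hcov⟩ := exists_finset_separated_cover hA (mul_pos two_pos hr)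
  obtain ⟨δ, hδs, hδ⟩ : ∃ δ : ℝ, (∀ x ∈ s, ∀ y ∈ s, x ≠ y → 2 * r + δ < dist x y) ∧ 0 < δ := by
    have h : ∀ᶠ δ : ℝ in nhds 0, ∀ x ∈ s, ∀ y ∈ s, x ≠ y → 2 * r + δ < dist x y := by
      refine (Filter.eventually_all_finset s).2 fun x hx =>
        (Filter.eventually_all_finset s).2 fun y hy => Filter.eventually_all.2 fun hxy => ?_
      have hc : Continuous fun δ : ℝ => 2 * r + δ := by fun_prop
      exact hc.continuousAt.eventually_lt continuousAt_const (by simpa using hsep x hx y hy hxy)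
    exact ((h.filter_mono nhdsWithin_le_nhds).and self_mem_nhdsWithin :
      ∀ᶠ δ : ℝ in nhdsWithin 0 (Set.Ioi 0), _ ∧ 0 < δ).exists
  have hSsub : S ⊆ ⋃ z ∈ s, ball z (l * r) := by
    intro x hx
    obtain ⟨w, hw, hxw⟩ := hS x hx
    obtain ⟨z, hz, hwz⟩ := hcov w hw
    refine Set.mem_iUnion₂.2 ⟨z, hz, ?_⟩
    rw [mem_ball]
    linarith [dist_triangle x w z]
  have hball : ∀ z ∈ s, μ (ball z (l * r)) ≤
      ENNReal.ofReal ((2 * l) ^ Real.logb 2 CX * (r / κ)) * codimOneHausdorff μ (A ∩ ball z r) := by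
    intro z hz
    calc μ (ball z (l * r)) ≤ ENNReal.ofReal ((2 * l) ^ Real.logb 2 CX) * μ (ball z r) :=
          measure_ball_mul_le hCX hdoub z hr hl
      _ = ENNReal.ofReal ((2 * l) ^ Real.logb 2 CX * (r / κ)) *
            (ENNReal.ofReal (κ / r) * μ (ball z r)) := by
          rw [← mul_assoc, ← ENNReal.ofReal_mul (by positivity)]
          congr 2
          field_simp
      _ ≤ _ := by
          gcongr
          exact hreg z (hsA hz) r hr hrη
  calc μ S ≤ μ (⋃ z ∈ s, ball z (l * r)) := measure_mono hSsub
    _ ≤ ∑ z ∈ s, μ (ball z (l * r)) := measure_biUnion_finset_le _ _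
    _ ≤ ∑ z ∈ s, ENNReal.ofReal ((2 * l) ^ Real.logb 2 CX * (r / κ)) *
          codimOneHausdorff μ (A ∩ ball z r) := Finset.sum_le_sum hball
    _ ≤ _ := by
        rw [← Finset.mul_sum]
        gcongr
        refine sum_codimOneHausdorff_le μ s _ hδ (fun x hx y hy hxy p hp q hq => ?_)
          fun _ _ => Set.inter_subset_left
        have hpx := mem_ball'.1 hp.2
        have hqy := mem_ball.1 hq.2
        linarith [hδs x hx y hy hxy, dist_triangle4 x p q y]

/-- Proposition `reduct`, estimate (eqred2).  Let `X` be an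
`M`-quasiconvex metric space with a doubling measure `μ` (constant `C_X`), set
`γ = log₂ C_X`, and suppose `∂Ω` is regular at scale `η` with constant `κ`.  Then for
`E ∈ {Ω, Ω^c}` and every `R > 0`,
`μ({x ∈ E^c : d(x,E) ≤ R}) ≤ ((8M)^γ/κ) · R · (1 + (R/η)^{γ−1}) · 𝓗(∂Ω)`. -/
theorem statement9 :
    ∀ (X : Type) (_ : MetricSpace X) (_ : MeasurableSpace X), ∀ (_ : BorelSpace X)
      (M : ℝ), 1 ≤ M → IsQuasiconvex X M →
      ∀ (μ : Measure X)
      (CX : ℝ), 1 ≤ CX →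
      (∀ (x : X) (r : ℝ), 0 < r → 0 < μ (Metric.ball x (2 * r)) ∧
        μ (Metric.ball x (2 * r)) ≤ ENNReal.ofReal CX * μ (Metric.ball x r)) →
      ∀ (Ω : Set X), IsCompact Ω →
      ∀ (η κ : ℝ), 0 < η → 0 < κ → IsRegularAtScale μ (frontier Ω) η κ →
      ∀ (E : Set X), (E = Ω ∨ E = Ωᶜ) →
      ∀ (R : ℝ), 0 < R →
        μ {x ∈ Eᶜ | EMetric.infEdist x E ≤ ENNReal.ofReal R} ≤
          ENNReal.ofReal (((8 * M) ^ (Real.logb 2 CX) / κ) * R *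
              (1 + (R / η) ^ (Real.logb 2 CX - 1))) *
            codimOneHausdorff μ (frontier Ω) := by
  intro X _ _ _ M hM hX μ CX hCX hdoub Ω hΩ η κ hη hκ hreg E hE R hR
  have hfr : frontier E = frontier Ω := by
    rcases hE with rfl | rfl
    · rfl
    · exact frontier_compl Ω
  have hA : TotallyBounded (frontier Ω) :=
    hΩ.totallyBounded.subset hΩ.isClosed.frontier_subset
  set r := min R η with hr_def
  have hr : 0 < r := lt_min hR hη
  have hrR : r ≤ R := min_le_left _ _
  have hl : 1 ≤ 4 * M * R / r := by
    rw [one_le_div hr]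
    nlinarith
  have hS : ∀ x ∈ {x ∈ Eᶜ | Metric.infEDist x E ≤ ENNReal.ofReal R},
      ∃ z ∈ frontier Ω, dist x z + 2 * r < 4 * M * R / r * r := by
    rintro x ⟨hxE, hx⟩
    have hx' : Metric.infEDist x E < ENNReal.ofReal (3 / 2 * R) :=
      lt_of_le_of_lt hx ((ENNReal.ofReal_lt_ofReal_iff (by positivity)).2 (by linarith))
    obtain ⟨y, hy, hxy⟩ := Metric.infEDist_lt_iff.1 hx'
    obtain ⟨z, hz, hxz⟩ := hX.exists_mem_frontier hxE hy
    rw [edist_lt_ofReal] at hxy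
    rw [edist_le_ofReal (by positivity)] at hxz
    refine ⟨z, hfr ▸ hz, ?_⟩
    rw [div_mul_cancel₀ _ hr.ne']
    nlinarith
  refine (measure_le_of_isRegularAtScale hCX (fun x r hr => (hdoub x r hr).2) hA hκ hreg hr
    (min_le_right _ _) hl hS).trans ?_
  refine mul_le_mul_left (ENNReal.ofReal_le_ofReal ?_) _
  set γ := Real.logb 2 CX
  have hpow : (R / r) ^ (γ - 1) ≤ 1 + (R / η) ^ (γ - 1) := by
    rcases min_choice R η with h | h
    · rw [hr_def, h, div_self hR.ne', Real.one_rpow]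
      linarith [Real.rpow_nonneg (div_nonneg hR.le hη.le) (γ - 1)]
    · rw [hr_def, h]
      linarith
  calc (2 * (4 * M * R / r)) ^ γ * (r / κ) = (8 * M) ^ γ / κ * R * (R / r) ^ (γ - 1) := by
        rw [show 2 * (4 * M * R / r) = 8 * M * (R / r) by ring,
          Real.mul_rpow (by positivity) (by positivity), Real.rpow_sub_one (by positivity)]
        field_simp
    _ ≤ _ := by gcongr

end Paper
end
end

section
/- Let (X,d) be an M-quasiconvex metric space and let E ⊆ X be a set with nonempty boundary ∂E. Then for every x ∈ E^c: d(x, ∂E) ≤ M · d(x, E). -/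
open MeasureTheory ENNReal Metric Filter

noncomputable section

namespace Paper

/-- A preconnected set meeting both `E` and its complement meets the frontier of `E`. -/
theorem exists_mem_frontier_of_isPreconnected {X : Type*} [TopologicalSpace X] {S E : Set X}
    (hS : IsPreconnected S) {x y : X} (hx : x ∈ S) (hxE : x ∉ E) (hy : y ∈ S) (hyE : y ∈ E) :
    ∃ p ∈ S, p ∈ frontier E := by
  by_contra! h
  obtain ⟨z, -, hz, hz'⟩ := hS (interior E) (interior Eᶜ) isOpen_interior isOpen_interior
    (fun z hz => by
      by_contra hn
      rw [Set.mem_union, not_or, interior_compl, Set.notMem_compl_iff] at hn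
      exact h z hz ⟨hn.2, hn.1⟩)
    ⟨y, hy, by
      by_contra hn
      exact h y hy ⟨subset_closure hyE, hn⟩⟩
    ⟨x, hx, by
      rw [interior_compl]
      exact fun hc => h x hx ⟨hc, fun hi => hxE (interior_subset hi)⟩⟩
  exact interior_subset hz' (interior_subset hz)

/-- In an `M`-quasiconvex metric space, for any set `E` with
nonempty boundary and any `x ∈ E^c`, one has `d(x,∂E) ≤ M·d(x,E)`. -/
theorem statement10 :
    ∀ (X : Type) (_ : MetricSpace X)
      (M : ℝ), 1 ≤ M → IsQuasiconvex X M →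
      ∀ (E : Set X), (frontier E).Nonempty →
      ∀ x ∈ Eᶜ,
        Metric.infDist x (frontier E) ≤ M * Metric.infDist x E := by
  intro X _ M hM hX E hE x hx
  have hM0 : 0 < M := one_pos.trans_le hM
  have hne : E.Nonempty := by
    by_contra h
    simp [Set.not_nonempty_iff_eq_empty.mp h] at hE
  rw [← div_le_iff₀' hM0, le_infDist hne]
  intro y hy
  rw [div_le_iff₀' hM0]
  obtain ⟨a, b, σ, hab, hσ, rfl, rfl, hlen⟩ := hX x y
  have ha : a ∈ Set.Icc a b := Set.left_mem_Icc.2 hab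
  obtain ⟨p, ⟨t, ht, rfl⟩, hp⟩ := exists_mem_frontier_of_isPreconnected
    (isPreconnected_Icc.image σ hσ) (Set.mem_image_of_mem σ ha) hx
    (Set.mem_image_of_mem σ (Set.right_mem_Icc.2 hab)) hy
  refine (infDist_le_dist_of_mem hp).trans ?_
  have h := (eVariationOn.edist_le σ ha ht).trans hlen
  rwa [edist_dist, ENNReal.ofReal_le_ofReal_iff (by positivity)] at h

end Paper
end
end

section
/- For every β > 1 there exists a constant C_β > 0 such that for all compact intervals I, J ⊆ ℝ and every δ ∈ (0, 1/2): #{λ ∈ σ(T_{I,J}) : δ < λ < 1−δ} ≤ C_β · log*(|I|·|J|·δ^{−1}) · (log*(δ^{−1} · log*(|I|·|J|)))^β, where T_{I,J} = P_I ∘ M_{1_J} ∘ P_I is the Fourier concentration (Toeplitz) operator on L²(ℝ). -/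
open MeasureTheory ENNReal Metric Filter

noncomputable section

namespace Paper

/-- `log* x = max {1, log x}`. -/
def logStar (x : ℝ) : ℝ := max 1 (Real.log x)

/-- Number of eigenvalues (with multiplicity, as a Hilbert dimension) of `T`
lying in the real set `S`: the Hilbert dimension of the closed span of the
eigenspaces `ker (T - λ)` over `λ ∈ S` (`⊤` if infinite). -/
def eigCount {E : Type*} [NormedAddCommGroup E] [InnerProductSpace ℂ E]
    (T : E →L[ℂ] E) (S : Set ℝ) : ℝ≥0∞ :=
  let V := (⨆ t : ℝ, ⨆ _ : t ∈ S,
      Module.End.eigenspace (T : E →ₗ[ℂ] E) (t : ℂ)).topologicalClosure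
  if Module.rank ℂ ↥V < Cardinal.aleph0 then ((Module.rank ℂ ↥V).toNat : ℝ≥0∞) else ⊤

open scoped InnerProductSpace

/-- The square-integrable complex functions on the line. -/
abbrev L2Line := ↥(Lp ℂ 2 (volume : Measure ℝ))

theorem mul_norm_sq_le_re_inner_sub_of_mem_iSup_eigenspace {E : Type*} [NormedAddCommGroup E]
    [InnerProductSpace ℂ E] {T : E →ₗ[ℂ] E} (hT : T.IsSymmetric) {δ : ℝ} {f : E}
    (hf : f ∈ ⨆ t : ℝ, ⨆ _ : t ∈ Set.Ioo δ (1 - δ), Module.End.eigenspace T (t : ℂ)) :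
    δ * (1 - δ) * ‖f‖ ^ 2 ≤ RCLike.re ⟪T f - T (T f), f⟫_ℂ := by
  rw [iSup_subtype', Submodule.mem_iSup_iff_exists_finsupp] at hf
  obtain ⟨u, hu, rfl⟩ := hf
  have hV : OrthogonalFamily ℂ
      (fun t : {t : ℝ // t ∈ Set.Ioo δ (1 - δ)} => Module.End.eigenspace T ((t : ℝ) : ℂ))
      fun t => (Module.End.eigenspace T ((t : ℝ) : ℂ)).subtypeₗᵢ :=
    hT.orthogonalFamily_eigenspaces.comp
      (f := fun t : {t : ℝ // t ∈ Set.Ioo δ (1 - δ)} => ((t : ℝ) : ℂ))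
      (fun a b h => Subtype.ext (Complex.ofReal_injective h))
  have hTu : ∀ t, T (u t) = ((t : ℝ) : ℂ) • u t := fun t => Module.End.mem_eigenspace_iff.1 (hu t)
  have h1 := hV.norm_sum (fun t => ⟨u t, hu t⟩) u.support
  have h2 := hV.inner_sum
    (fun t => ((((t : ℝ) - (t : ℝ) ^ 2 : ℝ)) : ℂ) • ⟨u t, hu t⟩) (fun t => ⟨u t, hu t⟩) u.support
  have h3 : T (∑ t ∈ u.support, u t) - T (T (∑ t ∈ u.support, u t)) =
      ∑ t ∈ u.support, ((((t : ℝ) - (t : ℝ) ^ 2 : ℝ)) : ℂ) • u t := by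
    rw [map_sum, map_sum, ← Finset.sum_sub_distrib]
    refine Finset.sum_congr rfl fun t _ => ?_
    rw [hTu, map_smul, hTu, smul_smul, ← sub_smul]
    push_cast
    ring_nf
  simp only [Submodule.coe_subtypeₗᵢ, Submodule.coe_subtype, Submodule.coe_smul, Submodule.coe_inner,
    Submodule.coe_norm] at h1 h2
  rw [Finsupp.sum, h3, h2, h1, Finset.mul_sum, map_sum]
  refine Finset.sum_le_sum fun t _ => ?_
  rw [inner_smul_left, inner_self_eq_norm_sq_to_K, Complex.conj_ofReal]
  have ht := t.2
  have : RCLike.re ((((t : ℝ) - (t : ℝ) ^ 2 : ℝ) : ℂ) * ((‖u t‖ : ℝ) : ℂ) ^ 2) =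
      ((t : ℝ) - (t : ℝ) ^ 2) * ‖u t‖ ^ 2 := by
    rw [← Complex.ofReal_pow, ← Complex.ofReal_mul]; exact Complex.ofReal_re _
  refine le_trans ?_ this.ge
  gcongr
  nlinarith [ht.1, ht.2]

theorem eigCount_le_card {E : Type*} [NormedAddCommGroup E] [InnerProductSpace ℂ E]
    {T : E →L[ℂ] E} (hT : (T : E →ₗ[ℂ] E).IsSymmetric) {δ : ℝ} (hδ : δ ∈ Set.Ioo (0 : ℝ) (1 / 2))
    (s : Finset E)
    (hs : ∀ f, (∀ v ∈ s, ⟪v, f⟫_ℂ = 0) → RCLike.re ⟪T f - T (T f), f⟫_ℂ ≤ δ / 2 * ‖f‖ ^ 2) :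
    eigCount T (Set.Ioo δ (1 - δ)) ≤ s.card := by
  set W : Submodule ℂ E := ⨆ t : ℝ, ⨆ _ : t ∈ Set.Ioo δ (1 - δ),
      Module.End.eigenspace (T : E →ₗ[ℂ] E) (t : ℂ)
  let φ : W →ₗ[ℂ] (s → ℂ) :=
    LinearMap.pi (fun v : s => ((innerSL ℂ (v : E)) : E →ₗ[ℂ] ℂ) ∘ₗ W.subtype)
  have hφ : Function.Injective φ := by
    rw [← LinearMap.ker_eq_bot, LinearMap.ker_eq_bot']
    rintro ⟨f, hf⟩ h0
    have h1 := hs f (fun v hv => by simpa [φ] using congrFun h0 ⟨v, hv⟩)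
    have h2 := mul_norm_sq_le_re_inner_sub_of_mem_iSup_eigenspace hT hf
    have h3 : (δ * (1 - δ) - δ / 2) * ‖f‖ ^ 2 ≤ 0 := by
      have := h2.trans h1
      linarith
    have h4 : 0 < δ * (1 - δ) - δ / 2 := by nlinarith [hδ.1, hδ.2]
    have h5 : ‖f‖ ^ 2 = 0 :=
      le_antisymm (nonpos_of_mul_nonpos_right h3 h4) (by positivity)
    exact Subtype.ext (by simpa using h5)
  have hfin : FiniteDimensional ℂ W := FiniteDimensional.of_injective φ hφ
  have hcl : W.topologicalClosure = W := W.closed_of_finiteDimensional.submodule_topologicalClosure_eq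
  have hle : Module.finrank ℂ W ≤ s.card := by
    simpa using LinearMap.finrank_le_finrank_of_injective hφ
  unfold eigCount
  simp only
  rw [hcl, if_pos (Module.rank_lt_aleph0 ℂ W)]
  exact_mod_cast hle

/-- Multiplication by the indicator function of `S`. -/
def restr {S : Set ℝ} (hS : MeasurableSet S) (g : L2Line) : L2Line :=
  MemLp.toLp (S.indicator ⇑g) ((Lp.memLp g).indicator hS)

theorem restr_ae {S : Set ℝ} (hS : MeasurableSet S) (g : L2Line) :
    ⇑(restr hS g) =ᵐ[volume] S.indicator ⇑g :=
  MemLp.coeFn_toLp _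

theorem norm_restr_le {S : Set ℝ} (hS : MeasurableSet S) (g : L2Line) : ‖restr hS g‖ ≤ ‖g‖ := by
  refine Lp.norm_le_norm_of_ae_le ?_
  filter_upwards [restr_ae hS g] with x h1
  rw [h1]
  exact norm_indicator_le_norm_self _ _

theorem restr_restr {S : Set ℝ} (hS : MeasurableSet S) (g : L2Line) :
    restr hS (restr hS g) = restr hS g := by
  ext1
  filter_upwards [restr_ae hS g, restr_ae hS (restr hS g)] with x h1 h2
  rw [h2]
  by_cases hx : x ∈ S <;> simp [hx, h1]

theorem inner_restr_left {S : Set ℝ} (hS : MeasurableSet S) (f g : L2Line) :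
    ⟪restr hS f, g⟫_ℂ = ⟪f, restr hS g⟫_ℂ := by
  rw [L2.inner_def, L2.inner_def]
  refine integral_congr_ae ?_
  filter_upwards [restr_ae hS f, restr_ae hS g] with x h1 h2
  rw [h1, h2]
  by_cases hx : x ∈ S <;> simp [hx]

theorem inner_restr_restr {S : Set ℝ} (hS : MeasurableSet S) (f g : L2Line) :
    ⟪restr hS f, restr hS g⟫_ℂ = ⟪restr hS f, g⟫_ℂ := by
  rw [← inner_restr_left, restr_restr]

theorem norm_restr_sq {S : Set ℝ} (hS : MeasurableSet S) (f : L2Line) :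
    ‖restr hS f‖ ^ 2 = RCLike.re ⟪restr hS f, f⟫_ℂ := by
  rw [← inner_restr_restr, norm_sq_eq_re_inner (𝕜 := ℂ)]

theorem restr_union {S S' U : Set ℝ} (hS : MeasurableSet S) (hS' : MeasurableSet S')
    (hU : MeasurableSet U) (hd : Disjoint S S') (h : S ∪ S' = U) (g : L2Line) :
    restr hU g = restr hS g + restr hS' g := by
  subst h
  ext1
  filter_upwards [restr_ae hS g, restr_ae hS' g, restr_ae hU g,
    Lp.coeFn_add (restr hS g) (restr hS' g)] with x h1 h2 h3 h4
  rw [h3, h4, Pi.add_apply, h1, h2, Set.indicator_union_of_disjoint hd]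

theorem restr_congr_ae {S S' : Set ℝ} (hS : MeasurableSet S) (hS' : MeasurableSet S')
    (h : S =ᵐ[volume] S') (g : L2Line) : restr hS g = restr hS' g := by
  ext1
  exact (restr_ae hS g).trans ((indicator_ae_eq_of_ae_eq_set h).trans (restr_ae hS' g).symm)

theorem eq_restr {S : Set ℝ} (hS : MeasurableSet S) {M : L2Line →L[ℂ] L2Line}
    (hM : ∀ f, ⇑(M f) =ᵐ[volume] fun x => S.indicator (fun _ => (1 : ℂ)) x * f x) (f : L2Line) :
    M f = restr hS f := by
  ext1
  filter_upwards [hM f, restr_ae hS f] with x h1 h2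
  rw [h1, h2]
  by_cases hx : x ∈ S <;> simp [hx]

theorem restr_add_restr_compl {S : Set ℝ} (hS : MeasurableSet S) (g : L2Line) :
    restr hS g + restr hS.compl g = g := by
  ext1
  filter_upwards [restr_ae hS g, restr_ae hS.compl g,
    Lp.coeFn_add (restr hS g) (restr hS.compl g)] with x h1 h2 h3
  rw [h3, Pi.add_apply, h1, h2]
  by_cases hx : x ∈ S <;> simp [hx]

theorem inner_restr_compl_restr {S : Set ℝ} (hS : MeasurableSet S) (f g : L2Line) :
    ⟪restr hS f, g⟫_ℂ = ⟪f, g⟫_ℂ - ⟪restr hS.compl f, g⟫_ℂ := by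
  rw [eq_sub_iff_add_eq, ← inner_add_left, restr_add_restr_compl]

theorem norm_sq_eq_integral (g : L2Line) : ‖g‖ ^ 2 = ∫ x, ‖g x‖ ^ 2 := by
  have h : ((‖g‖ ^ 2 : ℝ) : ℂ) = ((∫ x, ‖g x‖ ^ 2 : ℝ) : ℂ) := by
    rw [← integral_complex_ofReal, Complex.ofReal_pow]
    refine (inner_self_eq_norm_sq_to_K (𝕜 := ℂ) g).symm.trans ?_
    rw [L2.inner_def]
    refine integral_congr_ae (Filter.Eventually.of_forall fun x => ?_)
    simp only [Complex.ofReal_pow]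
    exact inner_self_eq_norm_sq_to_K (𝕜 := ℂ) (g x)
  exact_mod_cast h

theorem integrable_norm_sq (g : L2Line) : Integrable (fun x => ‖g x‖ ^ 2) :=
  (memLp_two_iff_integrable_sq_norm (Lp.aestronglyMeasurable g)).1 (Lp.memLp g)

theorem integrable_restr {S : Set ℝ} (hS : MeasurableSet S) (hfin : volume S ≠ ∞) (g : L2Line) :
    Integrable (⇑(restr hS g)) := by
  rw [integrable_congr (restr_ae hS g), integrable_indicator_iff hS]
  have : IsFiniteMeasure (volume.restrict S) := ⟨by simpa using hfin.lt_top⟩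
  exact ((Lp.memLp g).restrict S).integrable (by norm_num)

theorem integral_norm_restr_Ioc_le {x y : ℝ} (g : L2Line) :
    ∫ t, ‖restr (measurableSet_Ioc (a := x) (b := y)) g t‖ ≤ √(y - x) * ‖g‖ := by
  have hint := integrable_restr (measurableSet_Ioc (a := x) (b := y)) (by simp) g
  rw [integral_norm_eq_lintegral_enorm hint.1, ← eLpNorm_one_eq_lintegral_enorm,
    eLpNorm_congr_ae (restr_ae _ g), eLpNorm_indicator_eq_eLpNorm_restrict measurableSet_Ioc]
  have h1 := eLpNorm_le_eLpNorm_mul_rpow_measure_univ (μ := volume.restrict (Set.Ioc x y))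
    (p := 1) (q := 2) (f := ⇑g) (by norm_num) (Lp.aestronglyMeasurable g).restrict
  have h2 : eLpNorm g 2 (volume.restrict (Set.Ioc x y)) ≤ ENNReal.ofReal ‖g‖ := by
    rw [Lp.norm_def, ENNReal.ofReal_toReal (Lp.eLpNorm_ne_top g)]
    exact eLpNorm_restrict_le _ _ _ _
  have h3 : (volume.restrict (Set.Ioc x y)) Set.univ ^
      (1 / (1 : ℝ≥0∞).toReal - 1 / (2 : ℝ≥0∞).toReal) = ENNReal.ofReal (√(y - x)) := by
    rw [Measure.restrict_apply_univ, Real.volume_Ioc, Real.sqrt_eq_rpow]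
    norm_num
    rcases le_total 0 (y - x) with h | h
    · rw [ENNReal.ofReal_rpow_of_nonneg h (by norm_num)]
    · rw [ENNReal.ofReal_of_nonpos h, ← Real.sqrt_eq_rpow, Real.sqrt_eq_zero_of_nonpos h]
      simp
  refine ENNReal.toReal_le_of_le_ofReal (by positivity) (h1.trans ?_)
  rw [h3, mul_comm, ENNReal.ofReal_mul (by positivity)]
  gcongr

theorem integrable_mul_restr {S : Set ℝ} (hS : MeasurableSet S) (hfin : volume S ≠ ∞)
    (g : L2Line) {φ : ℝ → ℂ} (hφ : Measurable φ) {B : ℝ} (hB : ∀ η ∈ S, ‖φ η‖ ≤ B) :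
    Integrable (fun η => φ η * restr hS g η) := by
  refine ((integrable_restr hS hfin g).norm.const_mul B).mono'
    (hφ.aestronglyMeasurable.mul (Lp.aestronglyMeasurable _)) ?_
  filter_upwards [restr_ae hS g] with η h
  rw [norm_mul]
  by_cases hη : η ∈ S
  · gcongr
    exact hB η hη
  · simp [h, hη]

theorem norm_integral_mul_restr_le {S : Set ℝ} (hS : MeasurableSet S) (hfin : volume S ≠ ∞)
    (g : L2Line) {φ : ℝ → ℂ} {B : ℝ} (hB : ∀ η ∈ S, ‖φ η‖ ≤ B) :
    ‖∫ η, φ η * restr hS g η‖ ≤ B * ∫ η, ‖restr hS g η‖ := by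
  rw [← integral_const_mul]
  refine norm_integral_le_of_norm_le ((integrable_restr hS hfin g).norm.const_mul B) ?_
  filter_upwards [restr_ae hS g] with η h
  rw [norm_mul]
  by_cases hη : η ∈ S
  · gcongr
    exact hB η hη
  · simp [h, hη]

/-- `F` extends the integral Fourier transform. -/
def IsFourier (F : L2Line ≃ₗᵢ[ℂ] L2Line) : Prop :=
  ∀ f : L2Line, Integrable (⇑f) volume →
    ⇑(F f) =ᵐ[volume] fun ξ : ℝ =>
      ∫ x : ℝ, Complex.exp (-(2 * Real.pi * Complex.I) * ξ * x) * f x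

/-- The operator `𝓕 M_{1_[a,b]} 𝓕⁻¹`. -/
def conc (F : L2Line ≃ₗᵢ[ℂ] L2Line) (a b : ℝ) (g : L2Line) : L2Line :=
  F (restr (measurableSet_Icc (a := a) (b := b)) (F.symm g))

/-- The Fourier transform of the indicator function of `[a,b]`. -/
def kern (a b u : ℝ) : ℂ :=
  ∫ x in Set.Icc a b, Complex.exp (-(2 * Real.pi * Complex.I) * u * x)

theorem norm_cexp_mul_mul (u x : ℝ) :
    ‖Complex.exp (2 * Real.pi * Complex.I * u * x)‖ = 1 := by
  have : (2 * Real.pi * Complex.I * u * x : ℂ) = ((2 * Real.pi * u * x : ℝ) : ℂ) * Complex.I := by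
    push_cast; ring
  rw [this, Complex.norm_exp_ofReal_mul_I]

theorem norm_cexp_neg_mul_mul (u x : ℝ) :
    ‖Complex.exp (-(2 * Real.pi * Complex.I) * u * x)‖ = 1 := by
  have := norm_cexp_mul_mul (-u) x
  push_cast at this
  rw [← this]
  ring_nf

theorem norm_kern_le {a b : ℝ} (hab : a ≤ b) (u : ℝ) : ‖kern a b u‖ ≤ b - a := by
  have := norm_setIntegral_le_of_norm_le_const (μ := volume) (s := Set.Icc a b) (C := 1)
    (f := fun x : ℝ => Complex.exp (-(2 * Real.pi * Complex.I) * u * x)) (by simp)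
    (fun x _ => (norm_cexp_neg_mul_mul u x).le)
  simpa [kern, hab] using this

theorem kern_eq {a b : ℝ} (hab : a ≤ b) {u : ℝ} (hu : u ≠ 0) :
    kern a b u = (2 * Real.pi * Complex.I)⁻¹ *
      (Complex.exp (-(2 * Real.pi * Complex.I) * u * a) / u -
        Complex.exp (-(2 * Real.pi * Complex.I) * u * b) / u) := by
  have hu' : (u : ℂ) ≠ 0 := by exact_mod_cast hu
  have hπ : (Real.pi : ℂ) ≠ 0 := by exact_mod_cast Real.pi_ne_zero
  have hc : -(2 * Real.pi * Complex.I) * u ≠ 0 := by simp [hu', Real.pi_ne_zero]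
  rw [kern, integral_Icc_eq_integral_Ioc, ← intervalIntegral.integral_of_le hab,
    integral_exp_mul_complex hc]
  have := Complex.I_ne_zero
  field_simp
  ring

theorem memLp_indicator_cexp (a b ξ : ℝ) :
    MemLp ((Set.Icc a b).indicator
      (fun x : ℝ => Complex.exp (2 * Real.pi * Complex.I * ξ * x))) 2 volume := by
  rw [memLp_indicator_iff_restrict measurableSet_Icc]
  refine MemLp.of_bound (by fun_prop) 1 (Filter.Eventually.of_forall fun x => ?_)
  exact (norm_cexp_mul_mul ξ x).le

theorem conc_ae {F : L2Line ≃ₗᵢ[ℂ] L2Line} (hF : IsFourier F) (a b : ℝ) (g : L2Line) :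
    ⇑(conc F a b g) =ᵐ[volume] fun ξ => ∫ η, kern a b (ξ - η) * g η := by
  have hfin : volume (Set.Icc a b) ≠ ∞ := by simp
  refine (hF _ (integrable_restr measurableSet_Icc hfin _)).trans
    (Filter.Eventually.of_forall fun ξ => ?_)
  set e : L2Line := (memLp_indicator_cexp a b ξ).toLp _ with he
  have hee := (memLp_indicator_cexp a b ξ).coeFn_toLp
  rw [← he] at hee
  have hint : Integrable (⇑e) := by
    rw [integrable_congr hee, integrable_indicator_iff measurableSet_Icc]
    have := memLp_indicator_cexp a b ξ
    rw [memLp_indicator_iff_restrict measurableSet_Icc] at this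
    exact this.integrable (by norm_num)
  have h1 : (∫ x : ℝ, Complex.exp (-(2 * Real.pi * Complex.I) * ξ * x) *
      restr (measurableSet_Icc (a := a) (b := b)) (F.symm g) x) = ⟪e, F.symm g⟫_ℂ := by
    rw [L2.inner_def]
    refine integral_congr_ae ?_
    filter_upwards [hee, restr_ae (measurableSet_Icc (a := a) (b := b)) (F.symm g)] with x h1 h2
    rw [h1, h2, RCLike.inner_apply]
    by_cases hx : x ∈ Set.Icc a b
    · simp only [hx, Set.indicator_of_mem, ← Complex.exp_conj]
      rw [mul_comm]
      simp [Complex.conj_ofNat]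
    · simp only [hx, not_false_eq_true, Set.indicator_of_notMem]
      simp
  have h2 : ⟪e, F.symm g⟫_ℂ = ⟪F e, g⟫_ℂ := by
    rw [← F.inner_map_map e (F.symm g), F.apply_symm_apply]
  simp only
  rw [h1, h2, L2.inner_def]
  refine integral_congr_ae ?_
  filter_upwards [hF e hint] with η hη
  rw [hη, RCLike.inner_apply, mul_comm]
  congr 1
  rw [← integral_conj, kern, ← integral_indicator measurableSet_Icc]
  refine integral_congr_ae ?_
  filter_upwards [hee] with x hx
  rw [hx]
  by_cases hx : x ∈ Set.Icc a b
  · simp only [hx, Set.indicator_of_mem, ← Complex.exp_add, ← Complex.exp_conj]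
    congr 1
    simp [Complex.conj_ofNat]
    ring
  · simp [hx]

theorem norm_conc_restr_Ioc_le {F : L2Line ≃ₗᵢ[ℂ] L2Line} (hF : IsFourier F) {a b : ℝ}
    (hab : a ≤ b) {x y : ℝ} (g : L2Line) :
    ‖conc F a b (restr (measurableSet_Ioc (a := x) (b := y)) g)‖ ≤
      √((b - a) * (y - x)) * ‖g‖ := by
  set v := restr (measurableSet_Ioc (a := x) (b := y)) g with hv
  have hfin : volume (Set.Ioc x y) ≠ ∞ := by simp
  have hvint : Integrable (⇑v) := integrable_restr _ hfin g
  have h1 : ‖conc F a b v‖ ^ 2 = RCLike.re ⟪conc F a b v, v⟫_ℂ := by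
    rw [conc, F.norm_map, norm_restr_sq]
    conv_rhs => rw [← F.apply_symm_apply v, F.inner_map_map, F.symm_apply_apply]
  have h2 : ‖⟪conc F a b v, v⟫_ℂ‖ ≤ ∫ ξ, (b - a) * (∫ η, ‖v η‖) * ‖v ξ‖ := by
    rw [L2.inner_def]
    refine norm_integral_le_of_norm_le (hvint.norm.const_mul _) ?_
    filter_upwards [conc_ae hF a b v] with ξ hξ
    rw [hξ]
    refine (norm_inner_le_norm _ _).trans ?_
    gcongr
    exact norm_integral_mul_restr_le _ hfin g (fun η _ => norm_kern_le hab _)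
  rw [integral_const_mul] at h2
  have h3 : ∫ η, ‖v η‖ ≤ √(y - x) * ‖g‖ := integral_norm_restr_Ioc_le g
  have h4 : 0 ≤ ∫ η, ‖v η‖ := integral_nonneg fun _ => norm_nonneg _
  rw [Real.sqrt_mul (sub_nonneg.2 hab)]
  refine abs_le_of_sq_le_sq' ?_ (by positivity) |>.2
  rw [h1]
  refine (RCLike.re_le_norm _).trans (h2.trans ?_)
  have h5 : √(b - a) ^ 2 = b - a := Real.sq_sqrt (sub_nonneg.2 hab)
  calc (b - a) * (∫ η, ‖v η‖) * ∫ η, ‖v η‖ = √(b - a) ^ 2 * (∫ η, ‖v η‖) ^ 2 := by rw [h5]; ring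
    _ ≤ √(b - a) ^ 2 * (√(y - x) * ‖g‖) ^ 2 := by gcongr
    _ = _ := by ring

theorem inv_sub_eq_sum_add {ξ η c : ℂ} (h1 : ξ - c ≠ 0) (h2 : ξ - η ≠ 0) (m : ℕ) :
    (ξ - η)⁻¹ = ∑ k ∈ Finset.range m, (η - c) ^ k * ((ξ - c) ^ (k + 1))⁻¹ +
      ((η - c) / (ξ - c)) ^ m * (ξ - η)⁻¹ := by
  induction m with
  | zero => simp
  | succ m ih =>
    rw [Finset.sum_range_succ]
    conv_lhs => rw [ih]
    rw [add_assoc]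
    congr 1
    rw [div_pow, div_pow]
    field_simp
    ring

/-- The moment of order `k` of `exp (2πipη) v η` about `c` vanishes. -/
def MomentsVanish (p c : ℝ) (m : ℕ) (v : L2Line) : Prop :=
  ∀ k < m, ∫ η : ℝ, Complex.exp (2 * Real.pi * Complex.I * p * η) * ((η : ℂ) - c) ^ k * v η = 0

theorem abs_sub_le_of_mem_Ioc {c r η : ℝ} (h : η ∈ Set.Ioc (c - r) (c + r)) : |η - c| ≤ r :=
  abs_le.2 ⟨by linarith [h.1], by linarith [h.2]⟩

theorem two_thirds_mul_abs_le {ξ η c r : ℝ} (hξ : 3 * r ≤ |ξ - c|)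
    (hη : η ∈ Set.Ioc (c - r) (c + r)) : 2 / 3 * |ξ - c| ≤ |ξ - η| := by
  have h1 := abs_sub_le_of_mem_Ioc hη
  have h2 : |ξ - c| ≤ |ξ - η| + |η - c| := abs_sub_le _ _ _
  linarith

theorem norm_integral_cexp_div_le {c r : ℝ} (hr : 0 < r) {m : ℕ} {p : ℝ} {g : L2Line}
    (hg : MomentsVanish p c m (restr (measurableSet_Ioc (a := c - r) (b := c + r)) g))
    {ξ : ℝ} (hξ : 3 * r ≤ |ξ - c|) :
    ‖∫ η : ℝ, Complex.exp (-(2 * Real.pi * Complex.I) * (ξ - η : ℝ) * p) / (ξ - η : ℝ) *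
      restr (measurableSet_Ioc (a := c - r) (b := c + r)) g η‖ ≤
      3 / 2 * (1 / 3) ^ m / |ξ - c| *
        ∫ η, ‖restr (measurableSet_Ioc (a := c - r) (b := c + r)) g η‖ := by
  have hfin : volume (Set.Ioc (c - r) (c + r)) ≠ ∞ := by simp
  have hpos : 0 < |ξ - c| := by linarith
  have hne : ((ξ : ℂ) - c) ≠ 0 := by
    have := abs_pos.1 hpos
    exact_mod_cast this
  set v := restr (measurableSet_Ioc (a := c - r) (b := c + r)) g with hv
  set A : ℂ := Complex.exp (-(2 * Real.pi * Complex.I) * ξ * p) with hA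
  have hA1 : ‖A‖ = 1 := norm_cexp_neg_mul_mul ξ p
  set E : ℝ → ℂ := fun η => Complex.exp (2 * Real.pi * Complex.I * p * η) with hE
  have hE1 : ∀ η, ‖E η‖ = 1 := fun η => norm_cexp_mul_mul p η
  have hEm : Measurable E := by fun_prop
  have hint1 : ∀ k, Integrable (fun η : ℝ => E η * ((η : ℂ) - c) ^ k * v η) := fun k =>
    integrable_mul_restr _ hfin g (φ := fun η : ℝ => E η * ((η : ℂ) - c) ^ k) (by fun_prop)
      (B := r ^ k) (fun η hη => by
        rw [norm_mul, hE1, one_mul, norm_pow, ← Complex.ofReal_sub, Complex.norm_real]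
        gcongr
        exact abs_sub_le_of_mem_Ioc hη)
  have hbd : ∀ η ∈ Set.Ioc (c - r) (c + r),
      ‖A * E η * (((η : ℂ) - c) / (ξ - c)) ^ m * ((ξ : ℂ) - η)⁻¹‖ ≤
        3 / 2 * (1 / 3) ^ m / |ξ - c| := by
    intro η hη
    have h1 := two_thirds_mul_abs_le hξ hη
    rw [norm_mul, norm_mul, norm_mul, hA1, hE1, norm_pow, norm_div, norm_inv,
      ← Complex.ofReal_sub, ← Complex.ofReal_sub, ← Complex.ofReal_sub, Complex.norm_real,
      Complex.norm_real, Complex.norm_real, Real.norm_eq_abs, Real.norm_eq_abs, Real.norm_eq_abs]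
    have h2 : |η - c| / |ξ - c| ≤ 1 / 3 := by
      rw [div_le_iff₀ hpos]
      linarith [abs_sub_le_of_mem_Ioc hη]
    have h3 : |ξ - η|⁻¹ ≤ (2 / 3 * |ξ - c|)⁻¹ := by gcongr
    calc 1 * 1 * (|η - c| / |ξ - c|) ^ m * |ξ - η|⁻¹
        ≤ 1 * 1 * (1 / 3) ^ m * (2 / 3 * |ξ - c|)⁻¹ := by gcongr
      _ = _ := by field_simp
  have hint2 : Integrable (fun η : ℝ =>
      A * E η * (((η : ℂ) - c) / (ξ - c)) ^ m * ((ξ : ℂ) - η)⁻¹ * v η) :=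
    integrable_mul_restr _ hfin g
      (φ := fun η : ℝ => A * E η * (((η : ℂ) - c) / (ξ - c)) ^ m * ((ξ : ℂ) - η)⁻¹)
      (by fun_prop) hbd
  have hae : (fun η : ℝ =>
      Complex.exp (-(2 * Real.pi * Complex.I) * (ξ - η : ℝ) * p) / (ξ - η : ℝ) * v η) =ᵐ[volume]
      fun η => (∑ k ∈ Finset.range m,
        A * ((((ξ : ℂ) - c) ^ (k + 1))⁻¹) * (E η * ((η : ℂ) - c) ^ k * v η)) +
        A * E η * (((η : ℂ) - c) / (ξ - c)) ^ m * ((ξ : ℂ) - η)⁻¹ * v η := by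
    filter_upwards [restr_ae (measurableSet_Ioc (a := c - r) (b := c + r)) g] with η h
    by_cases hη : η ∈ Set.Ioc (c - r) (c + r)
    · have h1 := two_thirds_mul_abs_le hξ hη
      have h2 : ((ξ : ℂ) - η) ≠ 0 := by
        have : ξ - η ≠ 0 := abs_pos.1 (by linarith)
        exact_mod_cast this
      have h3 : Complex.exp (-(2 * Real.pi * Complex.I) * (ξ - η : ℝ) * p) = A * E η := by
        rw [hA, hE, ← Complex.exp_add]
        congr 1
        push_cast
        ring
      conv_lhs =>
        rw [h3, div_eq_mul_inv, Complex.ofReal_sub, inv_sub_eq_sum_add hne h2 m, mul_add, add_mul,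
          Finset.mul_sum, Finset.sum_mul]
      congr 1
      · refine Finset.sum_congr rfl fun k _ => ?_
        ring
      · ring
    · have : v η = 0 := by rw [hv, h]; simp [hη]
      simp [this]
  rw [integral_congr_ae hae, integral_add (integrable_finsetSum _ fun k _ =>
    (hint1 k).const_mul _) hint2, integral_finsetSum _ fun k _ => (hint1 k).const_mul _,
    Finset.sum_eq_zero, zero_add]
  · exact norm_integral_mul_restr_le _ hfin g hbd
  · intro k hk
    rw [integral_const_mul, hg k (Finset.mem_range.1 hk), mul_zero]

theorem norm_integral_kern_le {a b : ℝ} (hab : a ≤ b) {c r : ℝ} (hr : 0 < r) {m : ℕ} {g : L2Line}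
    (ha : MomentsVanish a c m (restr (measurableSet_Ioc (a := c - r) (b := c + r)) g))
    (hb : MomentsVanish b c m (restr (measurableSet_Ioc (a := c - r) (b := c + r)) g))
    {ξ : ℝ} (hξ : 3 * r ≤ |ξ - c|) :
    ‖∫ η : ℝ, kern a b (ξ - η) * restr (measurableSet_Ioc (a := c - r) (b := c + r)) g η‖ ≤
      (1 / 3) ^ m / |ξ - c| *
        ∫ η, ‖restr (measurableSet_Ioc (a := c - r) (b := c + r)) g η‖ := by
  have hfin : volume (Set.Ioc (c - r) (c + r)) ≠ ∞ := by simp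
  have hpos : 0 < |ξ - c| := by linarith
  have h1 := norm_integral_cexp_div_le hr ha hξ
  have h2 := norm_integral_cexp_div_le hr hb hξ
  set v := restr (measurableSet_Ioc (a := c - r) (b := c + r)) g with hv
  have hint : ∀ p : ℝ, Integrable (fun η : ℝ =>
      Complex.exp (-(2 * Real.pi * Complex.I) * (ξ - η : ℝ) * p) / (ξ - η : ℝ) * v η) := fun p =>
    integrable_mul_restr _ hfin g
      (φ := fun η : ℝ => Complex.exp (-(2 * Real.pi * Complex.I) * (ξ - η : ℝ) * p) / (ξ - η : ℝ))
      (by fun_prop) (B := (2 / 3 * |ξ - c|)⁻¹) (fun η hη => by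
        rw [norm_div, norm_cexp_neg_mul_mul, Complex.norm_real, Real.norm_eq_abs, one_div]
        have := two_thirds_mul_abs_le hξ hη
        gcongr)
  have hae : (fun η : ℝ => kern a b (ξ - η) * v η) =ᵐ[volume] fun η =>
      (2 * Real.pi * Complex.I)⁻¹ *
      (Complex.exp (-(2 * Real.pi * Complex.I) * (ξ - η : ℝ) * a) / (ξ - η : ℝ) * v η -
        Complex.exp (-(2 * Real.pi * Complex.I) * (ξ - η : ℝ) * b) / (ξ - η : ℝ) * v η) := by
    filter_upwards [restr_ae (measurableSet_Ioc (a := c - r) (b := c + r)) g] with η h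
    by_cases hη : η ∈ Set.Ioc (c - r) (c + r)
    · have h1 := two_thirds_mul_abs_le hξ hη
      have h2 : ξ - η ≠ 0 := abs_pos.1 (by linarith)
      rw [kern_eq hab h2]
      ring
    · have : v η = 0 := by rw [hv, h]; simp [hη]
      simp [this]
  rw [integral_congr_ae hae, integral_const_mul, integral_sub (hint a) (hint b), norm_mul]
  have h3 : ‖(2 * Real.pi * Complex.I : ℂ)⁻¹‖ ≤ 1 / 3 := by
    rw [norm_inv, norm_mul, norm_mul, Complex.norm_I, Complex.norm_real, Real.norm_eq_abs,
      abs_of_pos Real.pi_pos, mul_one, one_div]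
    have := Real.pi_gt_three
    have h2 : ‖(2 : ℂ)‖ = 2 := by simp
    rw [h2]
    gcongr
    linarith
  calc _ ≤ 1 / 3 * (3 / 2 * (1 / 3) ^ m / |ξ - c| * (∫ η, ‖v η‖) +
        3 / 2 * (1 / 3) ^ m / |ξ - c| * ∫ η, ‖v η‖) := by
        gcongr
        exact (norm_sub_le _ _).trans (add_le_add h1 h2)
    _ = _ := by ring

theorem integral_two_div_sq_add_sq {c R : ℝ} (hR : 0 < R) :
    Integrable (fun ξ : ℝ => 2 / ((ξ - c) ^ 2 + R ^ 2)) ∧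
      ∫ ξ : ℝ, 2 / ((ξ - c) ^ 2 + R ^ 2) = 2 * Real.pi / R := by
  have h : (fun ξ : ℝ => 2 / ((ξ - c) ^ 2 + R ^ 2)) =
      fun ξ => 2 / R ^ 2 * (fun x : ℝ => (fun y : ℝ => (1 + y ^ 2)⁻¹) (x / R)) (ξ - c) := by
    ext ξ
    field_simp
    ring
  rw [h]
  constructor
  · exact ((integrable_inv_one_add_sq.comp_div hR.ne').comp_sub_right c).const_mul _
  · rw [integral_const_mul,
      integral_sub_right_eq_self (fun x : ℝ => (fun y : ℝ => (1 + y ^ 2)⁻¹) (x / R)) c,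
      Measure.integral_comp_div (fun y : ℝ => (1 + y ^ 2)⁻¹), integral_univ_inv_one_add_sq,
      abs_of_pos hR, smul_eq_mul]
    field_simp

theorem norm_restr_compl_conc_le {F : L2Line ≃ₗᵢ[ℂ] L2Line} (hF : IsFourier F) {a b : ℝ}
    (hab : a ≤ b) {S : Set ℝ} (hS : MeasurableSet S) {c r : ℝ} (hr : 0 < r)
    (hfar : ∀ ξ ∉ S, 3 * r ≤ |ξ - c|) {m : ℕ} {g : L2Line}
    (ha : MomentsVanish a c m (restr (measurableSet_Ioc (a := c - r) (b := c + r)) g))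
    (hb : MomentsVanish b c m (restr (measurableSet_Ioc (a := c - r) (b := c + r)) g)) :
    ‖restr hS.compl (conc F a b (restr (measurableSet_Ioc (a := c - r) (b := c + r)) g))‖ ≤
      3 * (1 / 3) ^ m * ‖g‖ := by
  have hker := fun ξ (hξ : ξ ∉ S) => norm_integral_kern_le hab hr ha hb (hfar ξ hξ)
  have hL1 := integral_norm_restr_Ioc_le (x := c - r) (y := c + r) g
  set v := restr (measurableSet_Ioc (a := c - r) (b := c + r)) g with hv
  set D := ∫ η, ‖v η‖ with hD
  have hD0 : 0 ≤ D := integral_nonneg fun _ => norm_nonneg _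
  obtain ⟨hi1, hi2⟩ := integral_two_div_sq_add_sq (c := c) (R := 3 * r) (by positivity)
  have hsq : ‖restr hS.compl (conc F a b v)‖ ^ 2 ≤
      ∫ ξ, ((1 / 3) ^ m * D) ^ 2 * (2 / ((ξ - c) ^ 2 + (3 * r) ^ 2)) := by
    rw [norm_sq_eq_integral]
    refine integral_mono_ae (integrable_norm_sq _) (hi1.const_mul _) ?_
    filter_upwards [restr_ae hS.compl (conc F a b v), conc_ae hF a b v] with ξ h1 h2
    simp only [h1]
    by_cases hξ : ξ ∈ S
    · simp only [Set.mem_compl_iff, hξ, not_true_eq_false, not_false_eq_true,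
        Set.indicator_of_notMem, norm_zero]
      rw [zero_pow two_ne_zero]
      positivity
    · rw [Set.indicator_of_mem (by exact hξ), h2]
      have h3 := hfar ξ hξ
      have hpos : 0 < |ξ - c| := by linarith
      have h4 : (|ξ - c| ^ 2)⁻¹ ≤ 2 / ((ξ - c) ^ 2 + (3 * r) ^ 2) := by
        rw [← sq_abs (ξ - c), inv_eq_one_div, div_le_div_iff₀ (by positivity) (by positivity)]
        have : (3 * r) ^ 2 ≤ |ξ - c| ^ 2 := by gcongr
        linarith
      calc _ ≤ ((1 / 3) ^ m / |ξ - c| * D) ^ 2 := by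
            gcongr
            exact hker ξ hξ
        _ = ((1 / 3) ^ m * D) ^ 2 * (|ξ - c| ^ 2)⁻¹ := by field_simp
        _ ≤ _ := by gcongr
  rw [integral_const_mul, hi2] at hsq
  refine abs_le_of_sq_le_sq' ?_ (by positivity) |>.2
  refine hsq.trans ?_
  have h5 : D ^ 2 ≤ 2 * r * ‖g‖ ^ 2 := by
    calc D ^ 2 ≤ (√(c + r - (c - r)) * ‖g‖) ^ 2 := by gcongr
      _ = 2 * r * ‖g‖ ^ 2 := by
        rw [mul_pow, Real.sq_sqrt (by linarith)]
        ring
  have h6 : 2 * Real.pi / (3 * r) ≤ 8 / (3 * r) := by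
    gcongr
    linarith [Real.pi_le_four]
  calc ((1 / 3) ^ m * D) ^ 2 * (2 * Real.pi / (3 * r))
      = ((1 / 3 : ℝ) ^ m) ^ 2 * D ^ 2 * (2 * Real.pi / (3 * r)) := by ring
    _ ≤ ((1 / 3 : ℝ) ^ m) ^ 2 * (2 * r * ‖g‖ ^ 2) * (8 / (3 * r)) := by gcongr
    _ = ((1 / 3 : ℝ) ^ m) ^ 2 * ‖g‖ ^ 2 * (16 / 3) := by field_simp; ring
    _ ≤ ((1 / 3 : ℝ) ^ m) ^ 2 * ‖g‖ ^ 2 * 9 := by gcongr; norm_num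
    _ = _ := by ring

/-- Outside the set `T`, the operator `𝓕 M_{1_[a,b]} 𝓕⁻¹` is at most `ε` on functions supported
in `S` that are subject to `N` linear constraints. -/
def Negligible (F : L2Line ≃ₗᵢ[ℂ] L2Line) (a b : ℝ) {T S : Set ℝ} (hT : MeasurableSet T)
    (hS : MeasurableSet S) (N : ℕ) (ε : ℝ) : Prop :=
  ∃ w : Finset L2Line, w.card ≤ N ∧ ∀ g : L2Line, (∀ v ∈ w, ⟪v, g⟫_ℂ = 0) →
    ‖restr hT.compl (conc F a b (restr hS g))‖ ≤ ε * ‖g‖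

theorem restr_add {S : Set ℝ} (hS : MeasurableSet S) (f g : L2Line) :
    restr hS (f + g) = restr hS f + restr hS g := by
  ext1
  filter_upwards [restr_ae hS f, restr_ae hS g, restr_ae hS (f + g), Lp.coeFn_add f g,
    Lp.coeFn_add (restr hS f) (restr hS g)] with x h1 h2 h3 h4 h5
  rw [h3, h5, Pi.add_apply, h1, h2]
  by_cases hx : x ∈ S <;> simp only [hx, Set.indicator_of_mem, not_false_eq_true,
    Set.indicator_of_notMem, add_zero, h4, Pi.add_apply]

theorem conc_add (F : L2Line ≃ₗᵢ[ℂ] L2Line) (a b : ℝ) (f g : L2Line) :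
    conc F a b (f + g) = conc F a b f + conc F a b g := by
  rw [conc, map_add, restr_add, map_add, conc, conc]

theorem Negligible.union {F : L2Line ≃ₗᵢ[ℂ] L2Line} {a b : ℝ} {T S S' U : Set ℝ}
    {hT : MeasurableSet T} {hS : MeasurableSet S} {hS' : MeasurableSet S'} {hU : MeasurableSet U}
    {N N' : ℕ} {ε ε' : ℝ} (h : Negligible F a b hT hS N ε) (h' : Negligible F a b hT hS' N' ε')
    (hd : Disjoint S S') (hSU : S ∪ S' = U) :
    Negligible F a b hT hU (N + N') (ε + ε') := by
  classical
  obtain ⟨w, hw, hg⟩ := h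
  obtain ⟨w', hw', hg'⟩ := h'
  refine ⟨w ∪ w', (Finset.card_union_le _ _).trans (add_le_add hw hw'), fun g hgg => ?_⟩
  rw [restr_union hS hS' hU hd hSU, conc_add, restr_add, add_mul]
  exact (norm_add_le _ _).trans (add_le_add
    (hg g fun v hv => hgg v (Finset.mem_union_left _ hv))
    (hg' g fun v hv => hgg v (Finset.mem_union_right _ hv)))

theorem Negligible.mono {F : L2Line ≃ₗᵢ[ℂ] L2Line} {a b : ℝ} {T S : Set ℝ}
    {hT : MeasurableSet T} {hS : MeasurableSet S} {N N' : ℕ} {ε ε' : ℝ}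
    (h : Negligible F a b hT hS N ε) (hN : N ≤ N') (hε : ε ≤ ε') :
    Negligible F a b hT hS N' ε' := by
  obtain ⟨w, hw, hg⟩ := h
  exact ⟨w, hw.trans hN, fun g hgg => (hg g hgg).trans (by gcongr)⟩

theorem negligible_Ioc {F : L2Line ≃ₗᵢ[ℂ] L2Line} (hF : IsFourier F) {a b : ℝ} (hab : a ≤ b)
    {T : Set ℝ} (hT : MeasurableSet T) (x y : ℝ) :
    Negligible F a b hT (measurableSet_Ioc (a := x) (b := y)) 0 (√((b - a) * (y - x))) :=
  ⟨∅, by simp, fun g _ => (norm_restr_le _ _).trans (norm_conc_restr_Ioc_le hF hab g)⟩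

theorem exists_inner_eq_moment (p c r : ℝ) (k : ℕ) : ∃ w : L2Line, ∀ g : L2Line,
    ⟪w, g⟫_ℂ = ∫ η : ℝ, Complex.exp (2 * Real.pi * Complex.I * p * η) * ((η : ℂ) - c) ^ k *
      restr (measurableSet_Ioc (a := c - r) (b := c + r)) g η := by
  have hmem : MemLp ((Set.Ioc (c - r) (c + r)).indicator (fun η : ℝ =>
      starRingEnd ℂ (Complex.exp (2 * Real.pi * Complex.I * p * η) * ((η : ℂ) - c) ^ k)))
      2 volume := by
    rw [memLp_indicator_iff_restrict measurableSet_Ioc]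
    refine MemLp.of_bound ?_ (r ^ k) ?_
    · exact (Complex.continuous_conj.comp (by fun_prop)).aestronglyMeasurable
    · filter_upwards [ae_restrict_mem measurableSet_Ioc] with η hη
      rw [RCLike.norm_conj, norm_mul, norm_cexp_mul_mul, one_mul, norm_pow, ← Complex.ofReal_sub,
        Complex.norm_real]
      gcongr
      exact abs_sub_le_of_mem_Ioc hη
  refine ⟨hmem.toLp _, fun g => ?_⟩
  rw [L2.inner_def]
  refine integral_congr_ae ?_
  filter_upwards [hmem.coeFn_toLp,
    restr_ae (measurableSet_Ioc (a := c - r) (b := c + r)) g] with η h1 h2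
  rw [h1, h2, RCLike.inner_apply]
  by_cases hη : η ∈ Set.Ioc (c - r) (c + r)
  · simp only [hη, Set.indicator_of_mem, Complex.conj_conj]
    ring
  · simp [hη]

theorem negligible_Ioc_of_far {F : L2Line ≃ₗᵢ[ℂ] L2Line} (hF : IsFourier F) {a b : ℝ}
    (hab : a ≤ b) {T : Set ℝ} (hT : MeasurableSet T) {x y : ℝ} (hxy : x ≤ y)
    (hfar : ∀ ξ ∉ T, 3 * ((y - x) / 2) ≤ |ξ - (x + y) / 2|) (m : ℕ) :
    Negligible F a b hT (measurableSet_Ioc (a := x) (b := y)) (2 * m) (3 * (1 / 3) ^ m) := by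
  classical
  rcases hxy.eq_or_lt with rfl | hlt
  · refine (negligible_Ioc hF hab hT x x).mono (by omega) ?_
    rw [sub_self, mul_zero, Real.sqrt_zero]
    positivity
  obtain ⟨c, hc⟩ : ∃ c, c = (x + y) / 2 := ⟨_, rfl⟩
  obtain ⟨r, hr⟩ : ∃ r, r = (y - x) / 2 := ⟨_, rfl⟩
  have hr0 : 0 < r := by rw [hr]; linarith
  rw [← hc, ← hr] at hfar
  obtain rfl : x = c - r := by rw [hc, hr]; ring
  obtain rfl : y = c + r := by linarith
  choose w hw using fun (p : ℝ) (k : ℕ) => exists_inner_eq_moment p c r k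
  refine ⟨(Finset.range m).image (w a) ∪ (Finset.range m).image (w b), ?_, fun g hg => ?_⟩
  · refine (Finset.card_union_le _ _).trans ?_
    have h1 := Finset.card_image_le (s := Finset.range m) (f := w a)
    have h2 := Finset.card_image_le (s := Finset.range m) (f := w b)
    rw [Finset.card_range] at h1 h2
    omega
  · refine norm_restr_compl_conc_le hF hab hT hr0 hfar (fun k hk => ?_) (fun k hk => ?_)
    · rw [← hw a k g]
      exact hg _ (Finset.mem_union_left _ (Finset.mem_image_of_mem _ (Finset.mem_range.2 hk)))
    · rw [← hw b k g]
      exact hg _ (Finset.mem_union_right _ (Finset.mem_image_of_mem _ (Finset.mem_range.2 hk)))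

theorem negligible_left {F : L2Line ≃ₗᵢ[ℂ] L2Line} (hF : IsFourier F) {a b : ℝ}
    (hab : a ≤ b) {A B : ℝ} (m n : ℕ) : ∀ {s : ℝ}, 0 ≤ s → 2 * s ≤ B - A →
    Negligible F a b (measurableSet_Icc (a := A) (b := B))
      (measurableSet_Ioc (a := A) (b := A + s)) (2 * m * n)
      (3 * (1 / 3) ^ m * n + √((b - a) * (s / 2 ^ n))) := by
  induction n with
  | zero =>
    intro s hs _
    simpa using negligible_Ioc hF hab (measurableSet_Icc (a := A) (b := B)) A (A + s)
  | succ n ih =>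
    intro s hs hsB
    have h1 := ih (s := s / 2) (by linarith) (by linarith)
    have h2 := negligible_Ioc_of_far hF hab (measurableSet_Icc (a := A) (b := B))
      (x := A + s / 2) (y := A + s) (by linarith) (fun ξ hξ => ?_) m
    · refine (h1.union (hU := measurableSet_Ioc) h2 ?_ ?_).mono (le_of_eq (by ring)) (le_of_eq ?_)
      · exact Set.Ioc_disjoint_Ioc_of_le le_rfl
      · exact Set.Ioc_union_Ioc_eq_Ioc (by linarith) (by linarith)
      · rw [div_div, ← pow_succ']
        push_cast
        ring
    · rw [Set.mem_Icc, not_and_or, not_le, not_le] at hξ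
      rcases hξ with h | h
      · rw [abs_of_neg (by linarith)]
        linarith
      · rw [abs_of_pos (by linarith)]
        linarith

theorem negligible_right {F : L2Line ≃ₗᵢ[ℂ] L2Line} (hF : IsFourier F) {a b : ℝ}
    (hab : a ≤ b) {A B : ℝ} (m n : ℕ) : ∀ {s : ℝ}, 0 ≤ s → 2 * s ≤ B - A →
    Negligible F a b (measurableSet_Icc (a := A) (b := B))
      (measurableSet_Ioc (a := B - s) (b := B)) (2 * m * n)
      (3 * (1 / 3) ^ m * n + √((b - a) * (s / 2 ^ n))) := by
  induction n with
  | zero =>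
    intro s hs _
    simpa using negligible_Ioc hF hab (measurableSet_Icc (a := A) (b := B)) (B - s) B
  | succ n ih =>
    intro s hs hsB
    have h1 := ih (s := s / 2) (by linarith) (by linarith)
    have h2 := negligible_Ioc_of_far hF hab (measurableSet_Icc (a := A) (b := B))
      (x := B - s) (y := B - s / 2) (by linarith) (fun ξ hξ => ?_) m
    · refine (h2.union (hU := measurableSet_Ioc) h1 ?_ ?_).mono (le_of_eq (by ring)) (le_of_eq ?_)
      · exact Set.Ioc_disjoint_Ioc_of_le le_rfl
      · exact Set.Ioc_union_Ioc_eq_Ioc (by linarith) (by linarith)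
      · rw [div_div, ← pow_succ']
        push_cast
        ring
    · rw [Set.mem_Icc, not_and_or, not_le, not_le] at hξ
      rcases hξ with h | h
      · rw [abs_of_neg (by linarith)]
        linarith
      · rw [abs_of_pos (by linarith)]
        linarith

theorem negligible_Icc {F : L2Line ≃ₗᵢ[ℂ] L2Line} (hF : IsFourier F) {a b : ℝ}
    (hab : a ≤ b) {A B : ℝ} (hAB : A ≤ B) (m n : ℕ) :
    Negligible F a b (measurableSet_Icc (a := A) (b := B))
      (measurableSet_Icc (a := A) (b := B)) (4 * m * n)
      (6 * (1 / 3) ^ m * n + 2 * √((b - a) * ((B - A) / 2 / 2 ^ n))) := by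
  have h1 := negligible_left hF hab (A := A) (B := B) m n (s := (B - A) / 2)
    (by linarith) (by linarith)
  have h2 := negligible_right hF hab (A := A) (B := B) m n (s := (B - A) / 2)
    (by linarith) (by linarith)
  obtain ⟨w, hw, hg⟩ := (h1.union (U := Set.Ioc A B) (hU := measurableSet_Ioc) h2
    (Set.Ioc_disjoint_Ioc_of_le (by linarith))
    (by rw [show A + (B - A) / 2 = B - (B - A) / 2 by ring]
        exact Set.Ioc_union_Ioc_eq_Ioc (by linarith) (by linarith))).mono
    (N' := 4 * m * n) (le_of_eq (by ring))
    (ε' := 6 * (1 / 3) ^ m * n + 2 * √((b - a) * ((B - A) / 2 / 2 ^ n))) (le_of_eq (by ring))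
  refine ⟨w, hw, fun g hgg => ?_⟩
  rw [restr_congr_ae measurableSet_Icc measurableSet_Ioc Ioc_ae_eq_Icc.symm]
  exact hg g hgg

theorem inner_conc_left (F : L2Line ≃ₗᵢ[ℂ] L2Line) (a b : ℝ) (f g : L2Line) :
    ⟪conc F a b f, g⟫_ℂ = ⟪f, conc F a b g⟫_ℂ := by
  rw [conc, conc, ← F.symm.inner_map_map _ g, F.symm_apply_apply, inner_restr_left,
    ← F.inner_map_map, F.apply_symm_apply]

theorem conc_conc (F : L2Line ≃ₗᵢ[ℂ] L2Line) (a b : ℝ) (g : L2Line) :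
    conc F a b (conc F a b g) = conc F a b g := by
  rw [conc, conc, F.symm_apply_apply, restr_restr]

theorem isSymmetric_of_eq_conc {F : L2Line ≃ₗᵢ[ℂ] L2Line} {a b : ℝ} {S : Set ℝ}
    (hS : MeasurableSet S) {T : L2Line →L[ℂ] L2Line}
    (hT : ∀ f, T f = F.symm (restr hS (conc F a b (restr hS (F f))))) :
    (T : L2Line →ₗ[ℂ] L2Line).IsSymmetric := by
  intro f g
  rw [ContinuousLinearMap.coe_coe, hT, hT, ← F.inner_map_map, F.apply_symm_apply,
    ← F.inner_map_map f, F.apply_symm_apply, inner_restr_left, inner_conc_left, inner_restr_left]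

theorem re_inner_sub_eq_norm_sq {F : L2Line ≃ₗᵢ[ℂ] L2Line} {a b : ℝ} {S : Set ℝ}
    (hS : MeasurableSet S) {T : L2Line →L[ℂ] L2Line}
    (hT : ∀ f, T f = F.symm (restr hS (conc F a b (restr hS (F f))))) (f : L2Line) :
    RCLike.re ⟪T f - T (T f), f⟫_ℂ =
      ‖restr hS.compl (conc F a b (restr hS (F f)))‖ ^ 2 := by
  set u := restr hS (F f) with hu
  have h1 : ⟪T f, f⟫_ℂ = ⟪conc F a b u, conc F a b u⟫_ℂ := by
    rw [hT, ← F.inner_map_map, F.apply_symm_apply, inner_restr_left, ← hu, ← inner_conc_left,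
      conc_conc]
  have h2 : ⟪T (T f), f⟫_ℂ = ⟪restr hS (conc F a b u), conc F a b u⟫_ℂ := by
    rw [hT, ← F.inner_map_map, F.apply_symm_apply, inner_restr_left, ← hu, hT, F.apply_symm_apply,
      restr_restr, ← hu, inner_conc_left]
  rw [inner_sub_left, h1, h2, norm_restr_sq, inner_restr_compl_restr hS]
  congr 1
  ring

theorem one_le_logStar (x : ℝ) : 1 ≤ logStar x := le_max_left _ _

theorem natCeil_le_add_one {x y : ℝ} (hy : 0 ≤ y) (h : x ≤ y) : (⌈x⌉₊ : ℝ) ≤ y + 1 :=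
  (Nat.cast_le.2 (Nat.ceil_mono h)).trans (Nat.ceil_lt_add_one hy).le

theorem exists_scales {c δ : ℝ} (hc : 0 ≤ c) (hδ : δ ∈ Set.Ioo (0 : ℝ) (1 / 2)) :
    ∃ m n : ℕ, 6 * (1 / 3) ^ m * (n : ℝ) ≤ δ / 2 ∧ c / 2 / 2 ^ n ≤ δ / 32 ∧
      (m : ℝ) ≤ 9 * logStar (δ⁻¹ * logStar c) ∧ (n : ℝ) ≤ 9 * logStar (c * δ⁻¹) := by
  obtain ⟨hδ0, hδ1⟩ := hδ
  have hδi : 1 ≤ δ⁻¹ := (one_le_inv₀ hδ0).2 (by linarith)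
  set n := ⌈2 * Real.log (16 * c * δ⁻¹)⌉₊ with hn
  set m := ⌈Real.log (12 * n * δ⁻¹)⌉₊
  set L := logStar (c * δ⁻¹)
  set Λ := δ⁻¹ * logStar c
  have hL1 : 1 ≤ L := one_le_logStar _
  have hls1 : 1 ≤ logStar Λ := one_le_logStar _
  have hc1 : 1 ≤ logStar c := one_le_logStar _
  have hΛ1 : 1 ≤ Λ := one_le_mul_of_one_le_of_one_le hδi hc1
  have hlog2 := Real.log_two_gt_d9
  have hlog2' := Real.log_two_lt_d9
  have hnL : (n : ℝ) ≤ 9 * L := by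
    rcases hc.eq_or_lt with rfl | hc0
    · rw [hn]
      simp
      linarith
    have h1 : Real.log (16 * c * δ⁻¹) = 4 * Real.log 2 + Real.log (c * δ⁻¹) := by
      rw [mul_assoc, Real.log_mul (by norm_num) (by positivity),
        show (16 : ℝ) = 2 ^ 4 by norm_num, Real.log_pow]
      norm_num
    have h2 : Real.log (c * δ⁻¹) ≤ L := le_max_right _ _
    have h3 := natCeil_le_add_one (x := 2 * Real.log (16 * c * δ⁻¹)) (y := 6 + 2 * L)
      (by linarith) (by linarith)
    linarith
  have hLΛ : L ≤ 2 * Λ := by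
    refine max_le (by linarith) ?_
    rcases hc.eq_or_lt with rfl | hc0
    · simp
      linarith
    rw [Real.log_mul (by positivity) (by positivity)]
    have h1 : Real.log δ⁻¹ ≤ δ⁻¹ := (Real.log_le_sub_one_of_pos (by positivity)).trans (by linarith)
    have h2 : Real.log c ≤ logStar c := le_max_right _ _
    nlinarith
  refine ⟨m, n, ?_, ?_, ?_, hnL⟩
  · rcases Nat.eq_zero_or_pos n with h0 | h0
    · rw [h0]
      simp
      linarith
    have hn0 : (0 : ℝ) < n := by exact_mod_cast h0
    have h1 : 12 * n * δ⁻¹ ≤ 3 ^ m := by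
      calc 12 * n * δ⁻¹ = Real.exp (Real.log (12 * n * δ⁻¹)) := (Real.exp_log (by positivity)).symm
        _ ≤ Real.exp m := Real.exp_le_exp.2 (Nat.le_ceil _)
        _ = Real.exp 1 ^ m := by rw [← Real.exp_nat_mul, mul_one]
        _ ≤ 3 ^ m := by gcongr; linarith [Real.exp_one_lt_d9]
    rw [one_div, inv_pow]
    rw [← div_eq_mul_inv, div_le_iff₀ hδ0] at h1
    rw [mul_assoc, mul_comm _ (n : ℝ), ← mul_assoc, ← div_eq_mul_inv, div_le_iff₀ (by positivity)]
    linarith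
  · rcases hc.eq_or_lt with rfl | hc0
    · simp
      linarith
    have hx : 0 < 16 * c * δ⁻¹ := by positivity
    have h1 : 16 * c * δ⁻¹ ≤ 2 ^ n := by
      rw [← Real.log_le_log_iff hx (by positivity), Real.log_pow]
      have h2 : 2 * Real.log (16 * c * δ⁻¹) ≤ n := Nat.le_ceil _
      have h3 : (0 : ℝ) ≤ n := Nat.cast_nonneg n
      nlinarith
    rw [← div_eq_mul_inv, div_le_iff₀ hδ0] at h1
    rw [div_le_iff₀ (by positivity)]
    linarith
  · have h1 : Real.log (12 * n * δ⁻¹) ≤ 8 * logStar Λ := by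
      rcases Nat.eq_zero_or_pos n with h0 | h0
      · rw [h0]
        simp
        linarith
      have hn0 : (0 : ℝ) < n := by exact_mod_cast h0
      have h2 : 12 * n * δ⁻¹ ≤ 2 ^ 8 * Λ ^ 2 := by
        have h3 : δ⁻¹ ≤ Λ := le_mul_of_one_le_right (by linarith) hc1
        calc 12 * n * δ⁻¹ ≤ 12 * (9 * (2 * Λ)) * Λ := by gcongr; linarith
          _ ≤ _ := by nlinarith
      have h4 := Real.log_le_log (by positivity) h2
      have h6 : Real.log (2 ^ 8 * Λ ^ 2) = 8 * Real.log 2 + 2 * Real.log Λ := by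
        rw [Real.log_mul (by positivity) (by positivity), Real.log_pow, Real.log_pow]
        norm_num
      have h5 : Real.log Λ ≤ logStar Λ := le_max_right _ _
      rw [h6] at h4
      refine h4.trans ?_
      nlinarith only [h5, hlog2', hls1]
    have := natCeil_le_add_one (by linarith) h1
    linarith

/-- Theorem `theois`, after Israel.  For every `β > 1` there is
`C_β > 0` such that for all compact intervals `I, J ⊆ ℝ` and all `δ ∈ (0,1/2)`, the
Fourier concentration operator `T_{I,J} = P_I M_{1_J} P_I` on `L²(ℝ)` satisfies
`#{λ ∈ σ(T_{I,J}) : δ < λ < 1−δ} ≤ C_β log*(|I||J|δ⁻¹) (log*(δ⁻¹ log*(|I||J|)))^β`. -/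
theorem statement19 (β : ℝ) (hβ : 1 < β) :
    ∃ C : ℝ, 0 < C ∧
      -- the Fourier–Plancherel transform 𝓕, a unitary map of L²(ℝ) extending the
      -- integral Fourier transform
      ∀ (F : Lp ℂ 2 (volume : Measure ℝ) ≃ₗᵢ[ℂ] Lp ℂ 2 (volume : Measure ℝ)),
        (∀ f : Lp ℂ 2 (volume : Measure ℝ), MeasureTheory.Integrable (⇑f) volume →
          ⇑(F f) =ᵐ[volume] fun ξ : ℝ =>
            ∫ x : ℝ, Complex.exp (-(2 * Real.pi * Complex.I) * ξ * x) * f x) →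
      -- the endpoints of the compact intervals I and J
      ∀ (aI bI aJ bJ : ℝ), aI ≤ bI → aJ ≤ bJ →
      -- multiplication by the indicator functions of I and J
      ∀ (MI MJ : Lp ℂ 2 (volume : Measure ℝ) →L[ℂ] Lp ℂ 2 (volume : Measure ℝ)),
        (∀ f, ⇑(MI f) =ᵐ[volume] fun x =>
          Set.indicator (Set.Icc aI bI) (fun _ => (1:ℂ)) x * f x) →
        (∀ f, ⇑(MJ f) =ᵐ[volume] fun x =>
          Set.indicator (Set.Icc aJ bJ) (fun _ => (1:ℂ)) x * f x) →
      -- the Fourier concentration operator T_{I,J} = P_I M_{1_J} P_I,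
      -- where P_I = 𝓕⁻¹ M_{1_I} 𝓕
      ∀ (T : Lp ℂ 2 (volume : Measure ℝ) →L[ℂ] Lp ℂ 2 (volume : Measure ℝ)),
        (∀ f, T f = F.symm (MI (F (MJ (F.symm (MI (F f))))))) →
      ∀ δ : ℝ, δ ∈ Set.Ioo (0:ℝ) (1/2) →
        eigCount T (Set.Ioo δ (1 - δ)) ≤
          ENNReal.ofReal (C * logStar ((bI - aI) * (bJ - aJ) * δ⁻¹) *
            (logStar (δ⁻¹ * logStar ((bI - aI) * (bJ - aJ)))) ^ β) := by
  classical
  refine ⟨324, by norm_num, ?_⟩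
  intro F hF aI bI aJ bJ hI hJ MI MJ hMI hMJ T hT δ hδ
  have hTc : ∀ f, T f = F.symm (restr (measurableSet_Icc (a := aI) (b := bI))
      (conc F aJ bJ (restr (measurableSet_Icc (a := aI) (b := bI)) (F f)))) := fun f => by
    rw [hT, eq_restr measurableSet_Icc hMI, eq_restr measurableSet_Icc hMI,
      eq_restr measurableSet_Icc hMJ, conc]
  have hc : 0 ≤ (bI - aI) * (bJ - aJ) := mul_nonneg (sub_nonneg.2 hI) (sub_nonneg.2 hJ)
  obtain ⟨m, n, h1, h2, hm, hn⟩ := exists_scales hc hδ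
  obtain ⟨w, hw, hg⟩ := negligible_Icc (F := F) hF hJ hI m n
  set ε := 6 * (1 / 3) ^ m * (n : ℝ) + 2 * √((bJ - aJ) * ((bI - aI) / 2 / 2 ^ n))
  have hε2 : ε ^ 2 ≤ δ / 2 := by
    obtain ⟨hδ0, hδ1⟩ := hδ
    have h3 : √((bJ - aJ) * ((bI - aI) / 2 / 2 ^ n)) ^ 2 ≤ δ / 32 := by
      have hJ' := sub_nonneg.2 hJ
      have hI' := sub_nonneg.2 hI
      rw [Real.sq_sqrt (by positivity)]
      refine le_trans (le_of_eq ?_) h2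
      ring
    have h4 : (6 * (1 / 3) ^ m * (n : ℝ)) ^ 2 ≤ (δ / 2) ^ 2 := by gcongr
    have h5 := sq_nonneg
      (6 * (1 / 3) ^ m * (n : ℝ) - 2 * √((bJ - aJ) * ((bI - aI) / 2 / 2 ^ n)))
    nlinarith
  have hcard := eigCount_le_card (isSymmetric_of_eq_conc measurableSet_Icc hTc) hδ
    (w.image fun v => F.symm (restr (measurableSet_Icc (a := aI) (b := bI)) v)) (fun f hf => by
      rw [re_inner_sub_eq_norm_sq measurableSet_Icc hTc]
      have h3 := hg (restr (measurableSet_Icc (a := aI) (b := bI)) (F f)) (fun v hv => by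
        have := hf _ (Finset.mem_image_of_mem _ hv)
        rwa [← F.inner_map_map, F.apply_symm_apply, inner_restr_left] at this)
      rw [restr_restr] at h3
      have h4 : ‖restr (measurableSet_Icc (a := aI) (b := bI)) (F f)‖ ≤ ‖f‖ :=
        (norm_restr_le _ _).trans (F.norm_map f).le
      calc _ ≤ (ε * ‖restr (measurableSet_Icc (a := aI) (b := bI)) (F f)‖) ^ 2 := by gcongr
        _ = ε ^ 2 * ‖restr (measurableSet_Icc (a := aI) (b := bI)) (F f)‖ ^ 2 := by ring
        _ ≤ δ / 2 * ‖f‖ ^ 2 := by gcongr; linarith [hδ.1])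
  refine hcard.trans ?_
  rw [← ENNReal.ofReal_natCast]
  refine ENNReal.ofReal_le_ofReal ?_
  have h6 : ((w.image fun v => F.symm (restr (measurableSet_Icc (a := aI) (b := bI)) v)).card : ℝ) ≤
      4 * m * n := by exact_mod_cast Finset.card_image_le.trans hw
  have h7 := one_le_logStar (δ⁻¹ * logStar ((bI - aI) * (bJ - aJ)))
  have h8 : logStar (δ⁻¹ * logStar ((bI - aI) * (bJ - aJ))) ≤
      logStar (δ⁻¹ * logStar ((bI - aI) * (bJ - aJ))) ^ β :=
    Real.self_le_rpow_of_one_le h7 hβ.le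
  have h9 := one_le_logStar ((bI - aI) * (bJ - aJ) * δ⁻¹)
  calc _ ≤ 4 * (m : ℝ) * n := h6
    _ ≤ 4 * (9 * logStar (δ⁻¹ * logStar ((bI - aI) * (bJ - aJ)))) *
        (9 * logStar ((bI - aI) * (bJ - aJ) * δ⁻¹)) := by gcongr
    _ = 324 * logStar ((bI - aI) * (bJ - aJ) * δ⁻¹) *
        logStar (δ⁻¹ * logStar ((bI - aI) * (bJ - aJ))) := by ring
    _ ≤ _ := by gcongr

end Paper
end
end
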